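/- arXiv:1303.5127 — 7 statements merged into one kernel-verified Lean document; each statement's English description precedes it below -/
import Mathlib

section
/- Let κ_max > 0 and let κ_r : [0,∞) → ℝ be continuous with |κ_r(t)| ≤ κ_max for all t ≥ 0. Set a = 3/16, fix β > 8 and D > 0, and for k₂ > 0 set k₁ = a·k₂², C₂ = 1/(2βk₂), C₁ = a·C₂/(4k₂). Then there exists K > 0 such that for every k₂ ≥ K, every solution (y₁, y₂, ξ, η) : [0,∞) → ℝ⁴ of the closed-loop system ẏ₁ = −C₁σ(y₁) + (cos ξ − 1) + κ_r(t)(1 + C₁σ(y₁))·y₂, ẏ₂ = sin ξ − κ_r(t)(1 + C₁σ(y₁))·y₁, ξ̇ = η − κ_r(t)·C₁σ(y₁), η̇ = −D·σ((k₁/D)ξ + (k₂/D)η + (C₂/D)σ(y₂)) converges to (0,0,0,0) as t → ∞. -/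
/-- The standard saturation function `σ(x) = x / max(1, |x|)`. -/
noncomputable def sat (x : ℝ) : ℝ := x / max 1 |x|

lemma sat_cases (x : ℝ) :
    (-1 ≤ x ∧ x ≤ 1 ∧ sat x = x) ∨ (1 < x ∧ sat x = 1) ∨ (x < -1 ∧ sat x = -1) := by
  unfold sat
  rcases lt_or_ge 1 x with h | h
  · right; left
    rw [abs_of_pos (by linarith), max_eq_right h.le]
    exact ⟨h, div_self (by linarith)⟩
  rcases lt_or_ge x (-1) with h' | h'
  · right; right
    rw [abs_of_neg (by linarith), max_eq_right (by linarith)]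
    exact ⟨h', by rw [div_neg, div_self (by linarith)]⟩
  · left
    rw [max_eq_left (abs_le.2 ⟨h', h⟩), div_one]
    exact ⟨h', h, rfl⟩

lemma abs_sat_le_one (x : ℝ) : |sat x| ≤ 1 := by
  rw [abs_le]
  rcases sat_cases x with ⟨h1, h2, h⟩ | ⟨h1, h⟩ | ⟨h1, h⟩ <;> rw [h] <;> constructor <;> linarith

lemma abs_sat_add_sub_sat_le (x d : ℝ) : |sat (x + d) - sat x| ≤ |d| := by
  rw [abs_le]
  have h1 := le_abs_self d
  have h2 := neg_abs_le d
  rcases sat_cases x with ⟨_, _, h⟩ | ⟨_, h⟩ | ⟨_, h⟩ <;>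
  rcases sat_cases (x + d) with ⟨_, _, h'⟩ | ⟨_, h'⟩ | ⟨_, h'⟩ <;>
  rw [h, h'] <;> constructor <;> linarith

lemma sat_sq_le (x : ℝ) : sat x ^ 2 ≤ x * sat x := by
  rcases sat_cases x with ⟨_, _, h⟩ | ⟨_, h⟩ | ⟨_, h⟩ <;> rw [h] <;> nlinarith

lemma mul_sat_nonneg (x : ℝ) : 0 ≤ x * sat x := (sq_nonneg _).trans (sat_sq_le x)

/-- The primitive of `sat` that vanishes at `0`. -/
noncomputable def satPrim (x : ℝ) : ℝ := x * sat x - sat x ^ 2 / 2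

lemma satPrim_bounds (x : ℝ) : sat x ^ 2 / 2 ≤ satPrim x ∧ satPrim x ≤ x ^ 2 / 2 := by
  unfold satPrim
  rcases sat_cases x with ⟨_, _, h⟩ | ⟨_, h⟩ | ⟨_, h⟩ <;> rw [h] <;> constructor <;> nlinarith

lemma satPrim_sub_le (x y : ℝ) :
    |satPrim y - satPrim x - (y - x) * sat x| ≤ (y - x) ^ 2 := by
  unfold satPrim
  rw [abs_le]
  rcases sat_cases x with ⟨_, _, h⟩ | ⟨_, h⟩ | ⟨_, h⟩ <;>
  rcases sat_cases y with ⟨_, _, h'⟩ | ⟨_, h'⟩ | ⟨_, h'⟩ <;>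
  rw [h, h'] <;> constructor <;> nlinarith [sq_nonneg (y - x)]

lemma hasDerivAt_satPrim (x : ℝ) : HasDerivAt satPrim (sat x) x := by
  rw [hasDerivAt_iff_isLittleO]
  refine Asymptotics.IsBigO.trans_isLittleO (g := fun y => ‖y - x‖ ^ 2) ?_ ?_
  · refine Asymptotics.IsBigO.of_bound 1 (Filter.Eventually.of_forall fun y => ?_)
    simpa using satPrim_sub_le x y
  · exact Asymptotics.isLittleO_pow_sub_sub x one_lt_two

lemma abs_arctan_le_abs (x : ℝ) : |Real.arctan x| ≤ |x| := by
  have key : ∀ y : ℝ, 0 ≤ y → Real.arctan y ≤ y := fun y hy => by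
    have h0 : 0 ≤ Real.arctan y := Real.arctan_nonneg.2 hy
    have := Real.le_tan h0 (Real.arctan_lt_pi_div_two y)
    rwa [Real.tan_arctan] at this
  rcases le_total 0 x with h | h
  · rw [abs_of_nonneg h, abs_of_nonneg (Real.arctan_nonneg.2 h)]; exact key x h
  · have := key (-x) (by linarith)
    rw [abs_of_nonpos h, abs_of_nonpos (Real.arctan_le_zero.2 h), ← Real.arctan_neg]
    exact this

lemma abs_arctan_le_two_mul_abs_sat (x : ℝ) : |Real.arctan x| ≤ 2 * |sat x| := by
  have h1 := abs_arctan_le_abs x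
  have h2 : |Real.arctan x| ≤ 2 := by
    have := Real.pi_lt_four
    rw [abs_le]
    constructor <;> linarith [Real.arctan_lt_pi_div_two x, Real.neg_pi_div_two_lt_arctan x]
  rcases sat_cases x with ⟨_, _, h⟩ | ⟨_, h⟩ | ⟨_, h⟩ <;> rw [h]
  · linarith [abs_nonneg x]
  · simpa using h2
  · simpa using h2

/-- A function that decreases at a uniform rate while above a level is eventually below it. -/
lemma eventually_le_of_deriv_le_neg {f f' : ℝ → ℝ} {u r : ℝ} (hr : 0 < r)
    (hf : ∀ t ≥ (0 : ℝ), HasDerivWithinAt f (f' t) (Set.Ici 0) t)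
    (hdec : ∀ t ≥ (0 : ℝ), u ≤ f t → f' t ≤ -r) :
    ∃ T ≥ (0 : ℝ), ∀ t ≥ T, f t ≤ u := by
  have hcont : ContinuousOn f (Set.Ici 0) := fun t ht => (hf t ht).continuousWithinAt
  have hright : ∀ t ≥ (0 : ℝ), HasDerivWithinAt f (f' t) (Set.Ici t) t := fun t ht =>
    (hf t ht).mono (Set.Ici_subset_Ici.2 ht)
  have hT : ∃ T ≥ (0 : ℝ), f T ≤ u := by
    by_contra! hcon
    have hu : u < f 0 := hcon 0 le_rfl
    set T := (f 0 - u) / r with hTdef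
    have hT0 : 0 ≤ T := by rw [hTdef]; apply div_nonneg <;> linarith
    have hle : f T ≤ f 0 - r * T := by
      refine image_le_of_deriv_right_le_deriv_boundary (a := 0) (b := T) (f := f) (f' := f')
        (B := fun t => f 0 - r * t) (B' := fun _ => -r) (hcont.mono Set.Icc_subset_Ici_self)
        (fun t ht => hright t ht.1) (by simp) (by fun_prop) ?_ ?_ ⟨hT0, le_rfl⟩
      · intro t _
        have := ((hasDerivAt_id t).const_mul r).const_sub (f 0)
        simpa using this.hasDerivWithinAt
      · intro t ht
        exact hdec t ht.1 (hcon t ht.1).le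
    have : r * T = f 0 - u := by rw [hTdef]; field_simp
    linarith [hcon T hT0]
  obtain ⟨T, hT0, hTu⟩ := hT
  refine ⟨T, hT0, fun t ht => ?_⟩
  refine image_le_of_deriv_right_lt_deriv_boundary (a := T) (b := t) (f := f) (f' := f')
    (B := fun _ => u) (B' := fun _ => 0)
    (hcont.mono (Set.Icc_subset_Ici_self.trans (Set.Ici_subset_Ici.2 hT0)))
    (fun x hx => hright x (hT0.trans hx.1)) hTu (fun x => hasDerivAt_const x u) ?_ ⟨ht, le_rfl⟩
  intro x hx hxu
  linarith [hdec x (hT0.trans hx.1) hxu.ge]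

lemma le_of_deriv_nonpos {f f' : ℝ → ℝ} {T : ℝ}
    (hf : ∀ t ≥ T, HasDerivWithinAt f (f' t) (Set.Ici T) t) (hdec : ∀ t ≥ T, f' t ≤ 0) :
    ∀ t ≥ T, f t ≤ f T := fun t ht =>
  image_le_of_deriv_right_le_deriv_boundary (a := T) (b := t) (f := f) (f' := f')
    (B := fun _ => f T) (B' := fun _ => 0)
    (fun x hx => (hf x hx.1).continuousWithinAt.mono Set.Icc_subset_Ici_self)
    (fun x hx => (hf x hx.1).mono (Set.Ici_subset_Ici.2 hx.1)) le_rfl continuousOn_const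
    (fun x _ => hasDerivWithinAt_const x _ _) (fun x hx => hdec x hx.1) ⟨ht, le_rfl⟩

/-- Exponential decay from a differential inequality. -/
lemma tendsto_zero_of_deriv_le_neg_mul {f f' : ℝ → ℝ} {T c : ℝ} (hc : 0 < c)
    (hf : ∀ t ≥ T, HasDerivWithinAt f (f' t) (Set.Ici T) t)
    (hpos : ∀ t ≥ T, 0 ≤ f t) (hdec : ∀ t ≥ T, f' t ≤ -c * f t) :
    Filter.Tendsto f Filter.atTop (nhds 0) := by
  have hle : ∀ t ≥ T, f t ≤ f T * Real.exp (-c * (t - T)) := by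
    intro t ht
    have hg : ∀ x ≥ T, HasDerivWithinAt (fun x => f x * Real.exp (c * (x - T)))
        ((f' x + c * f x) * Real.exp (c * (x - T))) (Set.Ici T) x := by
      intro x hx
      have h1 : HasDerivAt (fun x => Real.exp (c * (x - T))) (Real.exp (c * (x - T)) * c) x := by
        have := (((hasDerivAt_id x).sub_const T).const_mul c).exp
        simpa using this
      refine ((hf x hx).mul h1.hasDerivWithinAt).congr_deriv ?_
      ring
    have hmain := le_of_deriv_nonpos hg (fun x hx => mul_nonpos_of_nonpos_of_nonneg
      (by linarith [hdec x hx]) (Real.exp_pos _).le) t ht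
    simp only [sub_self, mul_zero, Real.exp_zero, mul_one] at hmain
    have h2 : Real.exp (c * (t - T)) * Real.exp (-c * (t - T)) = 1 := by
      rw [← Real.exp_add]; simp
    calc f t = f t * Real.exp (c * (t - T)) * Real.exp (-c * (t - T)) := by
          rw [mul_assoc, h2, mul_one]
      _ ≤ _ := mul_le_mul_of_nonneg_right hmain (Real.exp_pos _).le
  have hlim : Filter.Tendsto (fun t => f T * Real.exp (-c * (t - T))) Filter.atTop (nhds 0) := by
    have : Filter.Tendsto (fun t : ℝ => -c * (t - T)) Filter.atTop Filter.atBot := by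
      refine Filter.Tendsto.const_mul_atTop_of_neg (by linarith) ?_
      exact Filter.tendsto_atTop_add_const_right _ (-T) Filter.tendsto_id
    simpa using (Real.tendsto_exp_atBot.comp this).const_mul (f T)
  refine tendsto_of_tendsto_of_tendsto_of_le_of_le' tendsto_const_nhds hlim ?_ ?_
  · filter_upwards [Filter.eventually_ge_atTop T] with t ht using hpos t ht
  · filter_upwards [Filter.eventually_ge_atTop T] with t ht using hle t ht

lemma inner_rate_le {S e φ p v d δ : ℝ} (hp0 : 0 ≤ p) (hp1 : p ≤ 1)
    (hφ : |φ| ≤ 2 * |S|) (he : |e| ≤ δ) (hep : |e| ≤ 5 * p * δ) (hd : |d| ≤ δ) :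
    S * (3 / 16 * v + 3 / 16 * d - (S + e)) - 3 / 16 * v * (S + e)
      - 1 / 16 * (p * (3 / 16 * v + 3 / 16 * d - (S + e)) * v + φ * -(S + e))
      ≤ -(1 / 2) * S ^ 2 - 3 / 512 * (p * v ^ 2) + 1000 * δ ^ 2 := by
  have hδ : 0 ≤ δ := (abs_nonneg _).trans he
  have t1 : -(v * e) ≤ |v| * (5 * p * δ) := by
    calc -(v * e) ≤ |v * e| := neg_le_abs _
      _ = |v| * |e| := abs_mul _ _
      _ ≤ _ := mul_le_mul_of_nonneg_left hep (abs_nonneg _)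
  have t2 : -(S * e) ≤ |S| * δ := by
    calc -(S * e) ≤ |S * e| := neg_le_abs _
      _ = |S| * |e| := abs_mul _ _
      _ ≤ _ := mul_le_mul_of_nonneg_left he (abs_nonneg _)
  have t3 : S * d ≤ |S| * δ := by
    calc S * d ≤ |S * d| := le_abs_self _
      _ = |S| * |d| := abs_mul _ _
      _ ≤ _ := mul_le_mul_of_nonneg_left hd (abs_nonneg _)
  have t4 : -(d * v) ≤ |v| * δ := by
    calc -(d * v) ≤ |d * v| := neg_le_abs _
      _ = |v| * |d| := by rw [abs_mul, mul_comm]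
      _ ≤ _ := mul_le_mul_of_nonneg_left hd (abs_nonneg _)
  have t5 : e * v ≤ |v| * δ := by
    calc e * v ≤ |e * v| := le_abs_self _
      _ = |v| * |e| := by rw [abs_mul, mul_comm]
      _ ≤ _ := mul_le_mul_of_nonneg_left he (abs_nonneg _)
  have t6 : φ * S ≤ 2 * S ^ 2 := by
    calc φ * S ≤ |φ * S| := le_abs_self _
      _ = |φ| * |S| := abs_mul _ _
      _ ≤ 2 * |S| * |S| := mul_le_mul_of_nonneg_right hφ (abs_nonneg _)
      _ = 2 * S ^ 2 := by rw [mul_assoc, ← sq, sq_abs]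
  have t7 : φ * e ≤ 2 * (|S| * δ) := by
    calc φ * e ≤ |φ * e| := le_abs_self _
      _ = |φ| * |e| := abs_mul _ _
      _ ≤ 2 * |S| * δ := mul_le_mul hφ he (abs_nonneg _) (by positivity)
      _ = _ := by ring
  have t8 : S * v ≤ 3 / 64 * v ^ 2 + 16 / 3 * S ^ 2 := by
    nlinarith [sq_nonneg (3 / 32 * v - S), sq_nonneg S, sq_nonneg v]
  have t9 : |S| * δ ≤ 1 / 200 * S ^ 2 + 50 * δ ^ 2 := by
    nlinarith [sq_nonneg (|S| - 100 * δ), sq_abs S]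
  have t10 : |v| * δ ≤ 1 / 1000 * v ^ 2 + 250 * δ ^ 2 := by
    nlinarith [sq_nonneg (|v| - 500 * δ), sq_abs v]
  have p4 := mul_le_mul_of_nonneg_left t4 hp0
  have p5 := mul_le_mul_of_nonneg_left t5 hp0
  have p8 := mul_le_mul_of_nonneg_left t8 hp0
  have p10 := mul_le_mul_of_nonneg_left t10 hp0
  have q1 : p * S ^ 2 ≤ S ^ 2 := mul_le_of_le_one_left (sq_nonneg _) hp1
  have q2 : p * δ ^ 2 ≤ δ ^ 2 := mul_le_of_le_one_left (sq_nonneg _) hp1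
  have q3 : 0 ≤ p * v ^ 2 := by positivity
  have q4 := sq_nonneg S
  nlinarith

/-- The strict Lyapunov function of the saturated double integrator. -/
noncomputable def innerLyap (s v : ℝ) : ℝ :=
  satPrim s + 3 / 32 * v ^ 2 - 1 / 16 * (Real.arctan s * v)

lemma innerLyap_lower (s v : ℝ) : 3 / 4 * satPrim s + 1 / 16 * v ^ 2 ≤ innerLyap s v := by
  unfold innerLyap
  have h1 : Real.arctan s ^ 2 ≤ 4 * sat s ^ 2 := by
    have := abs_arctan_le_two_mul_abs_sat s
    have := sq_le_sq' (by linarith [abs_nonneg (Real.arctan s), abs_nonneg (sat s)]) this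
    rw [sq_abs, mul_pow, sq_abs] at this
    linarith
  have h2 := (satPrim_bounds s).1
  nlinarith [sq_nonneg (Real.arctan s - v), sq_nonneg v]

lemma bounds_of_innerLyap_le {s v : ℝ} (h : innerLyap s v ≤ 1 / 32) : |s| ≤ 1 / 2 ∧ |v| ≤ 1 := by
  have h1 := innerLyap_lower s v
  have h2 : satPrim s ≤ 1 / 24 := by nlinarith [sq_nonneg v]
  have h3 : 0 ≤ satPrim s := (by positivity : 0 ≤ sat s ^ 2 / 2).trans (satPrim_bounds s).1
  constructor
  · unfold satPrim at h2
    rw [abs_le]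
    rcases sat_cases s with ⟨_, _, h⟩ | ⟨_, h⟩ | ⟨_, h⟩ <;> rw [h] at h2 <;> constructor <;>
      nlinarith
  · rw [abs_le]; constructor <;> nlinarith

lemma inner_rate_of_level_le {s v : ℝ} (h : 1 / 32 ≤ innerLyap s v) :
    3 / 32768 ≤ 1 / 2 * sat s ^ 2 + 3 / 512 * (1 / (1 + s ^ 2) * v ^ 2) := by
  have hpv : 0 ≤ 1 / (1 + s ^ 2) * v ^ 2 := by positivity
  rcases sat_cases s with ⟨h1, h2, hs⟩ | ⟨_, hs⟩ | ⟨_, hs⟩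
  · have hp : 1 / 2 ≤ 1 / (1 + s ^ 2) := by
      apply one_div_le_one_div_of_le <;> nlinarith
    have hpv' : 1 / 2 * v ^ 2 ≤ 1 / (1 + s ^ 2) * v ^ 2 :=
      mul_le_mul_of_nonneg_right hp (sq_nonneg v)
    have ha : -(Real.arctan s * v) ≤ |s| * |v| := by
      calc -(Real.arctan s * v) ≤ |Real.arctan s * v| := neg_le_abs _
        _ = |Real.arctan s| * |v| := abs_mul _ _
        _ ≤ _ := mul_le_mul_of_nonneg_right (abs_arctan_le_abs s) (abs_nonneg _)
    have hP := (satPrim_bounds s).2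
    unfold innerLyap at h
    rw [hs]
    have : 1 / 32 ≤ s ^ 2 + v ^ 2 := by
      nlinarith [sq_nonneg (|s| - |v|), sq_abs s, sq_abs v]
    nlinarith [sq_nonneg s]
  · rw [hs]; linarith
  · rw [hs]; linarith

/-- Under small disturbances the saturated double integrator reaches its linear regime. -/
lemma inner_eventually_bounded {s v d₁ d₂ : ℝ → ℝ} {k : ℝ} (hk : 0 < k)
    (hs : ∀ t ≥ (0 : ℝ), HasDerivWithinAt s
      (k * (3 / 16 * v t + 3 / 16 * d₁ t - sat (s t + d₂ t))) (Set.Ici 0) t)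
    (hv : ∀ t ≥ (0 : ℝ), HasDerivWithinAt v (k * -sat (s t + d₂ t)) (Set.Ici 0) t)
    (hd₁ : ∀ t ≥ (0 : ℝ), |d₁ t| ≤ 1 / 10000) (hd₂ : ∀ t ≥ (0 : ℝ), |d₂ t| ≤ 1 / 10000) :
    ∃ T ≥ (0 : ℝ), ∀ t ≥ T, |s t| ≤ 1 / 2 ∧ |v t| ≤ 1 := by
  suffices h : ∃ T ≥ (0 : ℝ), ∀ t ≥ T, innerLyap (s t) (v t) ≤ 1 / 32 by
    obtain ⟨T, hT0, hT⟩ := h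
    exact ⟨T, hT0, fun t ht => bounds_of_innerLyap_le (hT t ht)⟩
  refine eventually_le_of_deriv_le_neg (f := fun t => innerLyap (s t) (v t))
    (u := 1 / 32) (r := k * (1 / 100000))
    (f' := fun t => k * (sat (s t) * (3 / 16 * v t + 3 / 16 * d₁ t - sat (s t + d₂ t))
      - 3 / 16 * v t * sat (s t + d₂ t)
      - 1 / 16 * (1 / (1 + s t ^ 2) * (3 / 16 * v t + 3 / 16 * d₁ t - sat (s t + d₂ t)) * v t
        + Real.arctan (s t) * -sat (s t + d₂ t))))
    (by positivity) ?_ ?_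
  · intro t ht
    have h1 := (hasDerivAt_satPrim (s t)).comp_hasDerivWithinAt t (hs t ht)
    have h2 := ((hv t ht).pow 2).const_mul (3 / 32 : ℝ)
    have h3 := (((Real.hasDerivAt_arctan (s t)).comp_hasDerivWithinAt t (hs t ht)).mul
      (hv t ht)).const_mul (1 / 16 : ℝ)
    refine ((h1.add h2).sub h3).congr_deriv ?_
    simp only [Function.comp_apply]
    ring
  · intro t ht hu
    have hp0 : (0 : ℝ) ≤ 1 / (1 + s t ^ 2) := by positivity
    have hp1 : 1 / (1 + s t ^ 2) ≤ 1 := by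
      rw [div_le_one (by positivity)]; nlinarith [sq_nonneg (s t)]
    have he := (abs_sat_add_sub_sat_le (s t) (d₂ t)).trans (hd₂ t ht)
    have hep : |sat (s t + d₂ t) - sat (s t)| ≤ 5 * (1 / (1 + s t ^ 2)) * (1 / 10000) := by
      by_cases hst : |s t| ≤ 2
      · have : 1 / 5 ≤ 1 / (1 + s t ^ 2) := by
          apply one_div_le_one_div_of_le (by positivity)
          nlinarith [sq_abs (s t), abs_nonneg (s t)]
        linarith
      · have hz : sat (s t + d₂ t) - sat (s t) = 0 := by
          have hd := abs_le.1 (hd₂ t ht)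
          rcases lt_abs.1 (not_le.1 hst) with h | h
          · rcases sat_cases (s t) with ⟨_, _, h1⟩ | ⟨_, h1⟩ | ⟨_, h1⟩ <;>
            rcases sat_cases (s t + d₂ t) with ⟨_, _, h2⟩ | ⟨_, h2⟩ | ⟨_, h2⟩ <;>
            rw [h1, h2] <;> linarith
          · rcases sat_cases (s t) with ⟨_, _, h1⟩ | ⟨_, h1⟩ | ⟨_, h1⟩ <;>
            rcases sat_cases (s t + d₂ t) with ⟨_, _, h2⟩ | ⟨_, h2⟩ | ⟨_, h2⟩ <;>
            rw [h1, h2] <;> linarith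
        rw [hz, abs_zero]; positivity
    have hrate := inner_rate_le (v := v t) hp0 hp1 (abs_arctan_le_two_mul_abs_sat (s t)) he hep
      (hd₁ t ht)
    have hlev := inner_rate_of_level_le hu
    rw [add_sub_cancel] at hrate
    have : sat (s t) * (3 / 16 * v t + 3 / 16 * d₁ t - sat (s t + d₂ t))
      - 3 / 16 * v t * sat (s t + d₂ t)
      - 1 / 16 * (1 / (1 + s t ^ 2) * (3 / 16 * v t + 3 / 16 * d₁ t - sat (s t + d₂ t)) * v t
        + Real.arctan (s t) * -sat (s t + d₂ t)) ≤ -(1 / 100000) := by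
      linarith
    calc _ ≤ k * -(1 / 100000) := mul_le_mul_of_nonneg_left this hk.le
      _ = _ := by ring

lemma abs_mul_sq_le {y n : ℝ} (hn0 : 0 ≤ n) (hn : n ≤ 2) :
    |y| * n ^ 2 ≤ 4 * (y * sat y) + n ^ 2 := by
  have h4 : n ^ 2 ≤ 4 := by nlinarith
  have hA := mul_sat_nonneg y
  by_cases hy : |y| ≤ 1
  · nlinarith [sq_nonneg n]
  · have : y * sat y = |y| := by
      rcases lt_abs.1 (not_le.1 hy) with h | h
      · rcases sat_cases y with ⟨_, _, h1⟩ | ⟨_, h1⟩ | ⟨_, h1⟩ <;> rw [h1] <;>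
          [skip; rw [abs_of_pos (by linarith)]; skip] <;> linarith
      · rcases sat_cases y with ⟨_, _, h1⟩ | ⟨_, h1⟩ | ⟨_, h1⟩ <;> rw [h1] <;>
          [skip; skip; rw [abs_of_neg (by linarith)]] <;> linarith
    rw [this]
    nlinarith [abs_nonneg y, sq_nonneg n]

lemma abs_mul_le {y n : ℝ} (hn : n ≤ 2) :
    |y| * n ≤ 2 * (y * sat y) + n ^ 2 / 2 := by
  rcases sat_cases y with ⟨_, _, h⟩ | ⟨_, h⟩ | ⟨_, h⟩ <;> rw [h]
  · nlinarith [sq_nonneg (|y| - n / 2), sq_abs y]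
  · rw [abs_of_pos (by linarith)]; nlinarith [sq_nonneg n]
  · rw [abs_of_neg (by linarith)]; nlinarith [sq_nonneg n]

lemma sat_sq_mul_abs_le (x y : ℝ) : sat x ^ 2 * |y| ≤ x * sat x + y * sat y := by
  have h1 := sat_sq_le x
  have h2 : sat x ^ 2 ≤ 1 := by rw [sq_le_one_iff_abs_le_one]; exact abs_sat_le_one x
  have h3 := sq_nonneg (sat x)
  rcases sat_cases y with ⟨_, _, h⟩ | ⟨_, h⟩ | ⟨_, h⟩ <;> rw [h]
  · have : |y| ≤ 1 := abs_le.2 ⟨by linarith, by linarith⟩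
    nlinarith [sq_nonneg y]
  · rw [abs_of_pos (by linarith)]; nlinarith
  · rw [abs_of_neg (by linarith)]; nlinarith

/-- Quadratic dissipation of the double integrator in its linear regime. -/
lemma linear_rate_le (s v d₁ d₂ : ℝ) :
    (s - v / 16) * (3 / 16 * v + 3 / 16 * d₁ - (s + d₂)) + (3 / 16 * v - s / 16) * -(s + d₂)
      ≤ -(1 / 256) * (s ^ 2 + v ^ 2) + 400 * (d₁ ^ 2 + d₂ ^ 2) := by
  nlinarith [sq_nonneg (s - 4 * d₁), sq_nonneg (s + 4 * d₂), sq_nonneg (v - 16 * d₁),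
    sq_nonneg (v - 16 * d₂), sq_nonneg (v + 16 * d₁),
    sq_nonneg (v + 16 * d₂), sq_nonneg (s + v), sq_nonneg (s - v), sq_nonneg (s - v / 8),
    sq_nonneg (s + 4 * d₁), sq_nonneg (s - 4 * d₂), sq_nonneg d₁, sq_nonneg d₂]

lemma abs_sin_sub_self_le_sq (x : ℝ) : |Real.sin x - x| ≤ x ^ 2 := by
  rw [abs_sub_comm, ← sq_abs x]
  rcases le_total |x| 2 with h | h
  · refine (Real.abs_sub_sin_le x).trans ?_
    nlinarith [pow_nonneg (abs_nonneg x) 2]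
  · calc |x - Real.sin x| ≤ |x| + |Real.sin x| := abs_sub _ _
      _ ≤ |x| + |x| := by linarith [Real.abs_sin_le_abs (x := x)]
      _ ≤ |x| ^ 2 := by nlinarith

lemma abs_cos_sub_one_le (x : ℝ) : |Real.cos x - 1| ≤ x ^ 2 / 2 := by
  rw [abs_le]
  constructor <;> nlinarith [Real.one_sub_sq_div_two_le_cos (x := x), Real.cos_le_one x]

lemma mul_le_of_abs_le {x y a b : ℝ} (hx : |x| ≤ a) (hy : |y| ≤ b) : x * y ≤ a * b :=
  (le_abs_self _).trans ((abs_mul x y).le.trans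
    (mul_le_mul hx hy (abs_nonneg _) ((abs_nonneg _).trans hx)))

/-- Bound on the terms of the derivative of the position part of the Lyapunov function that
do not have a sign. -/
lemma position_error_le {y₁ y₂ ξ X n N κ κm D b ε : ℝ} (hn0 : 0 ≤ n) (hn : n ≤ 2)
    (hnN : n ^ 2 ≤ 2 * N) (hκ : |κ| ≤ κm) (hD : 0 < D) (hb : 0 < b) (hb1 : b ≤ 1)
    (hε : 0 < ε) (hε1 : ε ≤ 1)
    (hξ : |ξ| ≤ 6 * D * n * ε ^ 2) (hX : |X| ≤ 30 * D * n * ε ^ 3) :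
    y₁ * (Real.cos ξ - 1) + y₂ * (Real.sin ξ - ξ)
      + (Real.sin ξ - κ * (1 + 3 / 128 * b * ε ^ 2 * sat y₁) * y₁) * X
      + b * ε ^ 3 / 8 * (sat y₁ * (Real.cos ξ - 1)
        + κ * (3 / 128 * b * ε ^ 2) * sat y₁ ^ 2 * y₂)
      ≤ (72 * D ^ 2 + 120 * D * κm + κm * b ^ 2) * ε ^ 3 * (y₁ * sat y₁)
        + (144 * D ^ 2 + κm * b ^ 2) * ε ^ 4 * (y₂ * sat y₂)
        + (500 * D ^ 2 + 60 * D * κm + 5 * b * D ^ 2) * ε ^ 2 * N := by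
  have hN : 0 ≤ N := by nlinarith [sq_nonneg n]
  have hκm : 0 ≤ κm := (abs_nonneg _).trans hκ
  have hA1 := mul_sat_nonneg y₁
  have hA2 := mul_sat_nonneg y₂
  have hξ2 : ξ ^ 2 ≤ 36 * D ^ 2 * ε ^ 4 * n ^ 2 := by
    have := pow_le_pow_left₀ (abs_nonneg ξ) hξ 2
    rw [sq_abs] at this
    linarith [this, (by ring : (6 * D * n * ε ^ 2) ^ 2 = 36 * D ^ 2 * ε ^ 4 * n ^ 2)]
  have e43 : ε ^ 4 ≤ ε ^ 3 := pow_le_pow_of_le_one hε.le hε1 (by norm_num)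
  have e42 : ε ^ 4 ≤ ε ^ 2 := pow_le_pow_of_le_one hε.le hε1 (by norm_num)
  have e52 : ε ^ 5 ≤ ε ^ 2 := pow_le_pow_of_le_one hε.le hε1 (by norm_num)
  have e53 : ε ^ 5 ≤ ε ^ 3 := pow_le_pow_of_le_one hε.le hε1 (by norm_num)
  have e54 : ε ^ 5 ≤ ε ^ 4 := pow_le_pow_of_le_one hε.le hε1 (by norm_num)
  have e32 : ε ^ 3 ≤ ε ^ 2 := pow_le_pow_of_le_one hε.le hε1 (by norm_num)
  have e72 : ε ^ 7 ≤ ε ^ 2 := pow_le_pow_of_le_one hε.le hε1 (by norm_num)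
  have hcos : |Real.cos ξ - 1| ≤ 18 * D ^ 2 * ε ^ 4 * n ^ 2 :=
    (abs_cos_sub_one_le ξ).trans (by linarith)
  have hsin : |Real.sin ξ - ξ| ≤ 36 * D ^ 2 * ε ^ 4 * n ^ 2 :=
    (abs_sin_sub_self_le_sq ξ).trans hξ2
  have ta : y₁ * (Real.cos ξ - 1) ≤ 18 * D ^ 2 * ε ^ 4 * (4 * (y₁ * sat y₁) + 2 * N) := by
    calc y₁ * (Real.cos ξ - 1) ≤ |y₁| * (18 * D ^ 2 * ε ^ 4 * n ^ 2) := mul_le_of_abs_le le_rfl hcos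
      _ = 18 * D ^ 2 * ε ^ 4 * (|y₁| * n ^ 2) := by ring
      _ ≤ _ := by gcongr; linarith [abs_mul_sq_le (y := y₁) hn0 hn]
  have tb : y₂ * (Real.sin ξ - ξ) ≤ 36 * D ^ 2 * ε ^ 4 * (4 * (y₂ * sat y₂) + 2 * N) := by
    calc y₂ * (Real.sin ξ - ξ) ≤ |y₂| * (36 * D ^ 2 * ε ^ 4 * n ^ 2) := mul_le_of_abs_le le_rfl hsin
      _ = 36 * D ^ 2 * ε ^ 4 * (|y₂| * n ^ 2) := by ring
      _ ≤ _ := by gcongr; linarith [abs_mul_sq_le (y := y₂) hn0 hn]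
  have tc : Real.sin ξ * X ≤ 180 * D ^ 2 * ε ^ 5 * (2 * N) := by
    calc Real.sin ξ * X ≤ (6 * D * n * ε ^ 2) * (30 * D * n * ε ^ 3) :=
          mul_le_of_abs_le (Real.abs_sin_le_abs.trans hξ) hX
      _ = 180 * D ^ 2 * ε ^ 5 * n ^ 2 := by ring
      _ ≤ _ := by gcongr
  have hfac : |-(κ * (1 + 3 / 128 * b * ε ^ 2 * sat y₁) * y₁)| ≤ κm * 2 * |y₁| := by
    rw [abs_neg, abs_mul, abs_mul]
    gcongr
    have h1 : |3 / 128 * b * ε ^ 2 * sat y₁| ≤ 1 * 1 := by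
      rw [abs_mul]
      refine mul_le_mul ?_ (abs_sat_le_one _) (abs_nonneg _) zero_le_one
      rw [abs_of_nonneg (by positivity)]
      have : ε ^ 2 ≤ 1 := pow_le_one₀ hε.le hε1
      have : b * ε ^ 2 ≤ 1 := mul_le_one₀ hb1 (by positivity) this
      linarith
    calc |1 + 3 / 128 * b * ε ^ 2 * sat y₁| ≤ |(1 : ℝ)| + |3 / 128 * b * ε ^ 2 * sat y₁| :=
          abs_add_le _ _
      _ ≤ 2 := by rw [abs_one]; linarith
  have td : -(κ * (1 + 3 / 128 * b * ε ^ 2 * sat y₁) * y₁) * X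
      ≤ 60 * D * κm * ε ^ 3 * (2 * (y₁ * sat y₁) + N) := by
    calc _ ≤ (κm * 2 * |y₁|) * (30 * D * n * ε ^ 3) := mul_le_of_abs_le hfac hX
      _ = 60 * D * κm * ε ^ 3 * (|y₁| * n) := by ring
      _ ≤ _ := by gcongr; linarith [abs_mul_le (y := y₁) hn]
  have te : sat y₁ * (Real.cos ξ - 1) ≤ 36 * D ^ 2 * ε ^ 4 * N := by
    calc sat y₁ * (Real.cos ξ - 1) ≤ 1 * (18 * D ^ 2 * ε ^ 4 * n ^ 2) :=
          mul_le_of_abs_le (abs_sat_le_one _) hcos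
      _ = 18 * D ^ 2 * ε ^ 4 * n ^ 2 := by ring
      _ ≤ 18 * D ^ 2 * ε ^ 4 * (2 * N) := by gcongr
      _ = _ := by ring
  have tf : κ * (sat y₁ ^ 2 * y₂) ≤ κm * (y₁ * sat y₁ + y₂ * sat y₂) := by
    refine mul_le_of_abs_le hκ ?_
    rw [abs_mul, abs_of_nonneg (sq_nonneg _)]
    exact sat_sq_mul_abs_le y₁ y₂
  have te' := mul_le_mul_of_nonneg_left te (by positivity : 0 ≤ b * ε ^ 3 / 8)
  have tf' := mul_le_mul_of_nonneg_left tf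
    (by positivity : 0 ≤ b * ε ^ 3 / 8 * (3 / 128 * b * ε ^ 2))
  have c1 : 72 * D ^ 2 * ε ^ 4 * (y₁ * sat y₁) ≤ 72 * D ^ 2 * ε ^ 3 * (y₁ * sat y₁) := by gcongr
  have c2 : κm * b ^ 2 * ε ^ 5 * (y₁ * sat y₁) ≤ κm * b ^ 2 * ε ^ 3 * (y₁ * sat y₁) := by gcongr
  have c3 : κm * b ^ 2 * ε ^ 5 * (y₂ * sat y₂) ≤ κm * b ^ 2 * ε ^ 4 * (y₂ * sat y₂) := by gcongr
  have c4 : D ^ 2 * ε ^ 4 * N ≤ D ^ 2 * ε ^ 2 * N := by gcongr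
  have c5 : D ^ 2 * ε ^ 5 * N ≤ D ^ 2 * ε ^ 2 * N := by gcongr
  have c6 : D * κm * ε ^ 3 * N ≤ D * κm * ε ^ 2 * N := by gcongr
  have c7 : b * D ^ 2 * ε ^ 7 * N ≤ b * D ^ 2 * ε ^ 2 * N := by gcongr
  have p1 : 0 ≤ κm * b ^ 2 * ε ^ 5 * (y₁ * sat y₁) := by positivity
  have p2 : 0 ≤ κm * b ^ 2 * ε ^ 5 * (y₂ * sat y₂) := by positivity
  have p3 : 0 ≤ b * D ^ 2 * ε ^ 7 * N := by positivity
  have p4 : 0 ≤ D ^ 2 * ε ^ 2 * N := by positivity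
  linear_combination ta + tb + tc + td + te' + tf' + c1 + 3 / 1024 * c2 + 3 / 1024 * c3 + 108 * c4
    + 360 * c5 + 60 * c6 + 36 / 8 * c7 + (1021 / 1024) * (p1 + (c2)) + 1021 / 1024 * (p2 + c3)
    + 1 / 2 * (p3 + c7) + 32 * p4

/-- The Lyapunov function of the closed loop once the inner saturation is inactive, in terms of
`s = (k₁ ξ + k₂ η) / D` and `v = k₂ η / D`. -/
noncomputable def outerLyap (D b ε y₁ y₂ s v : ℝ) : ℝ :=
  (y₁ ^ 2 + y₂ ^ 2) / 2 + y₂ * (D * ε ^ 3 * (16 / 3) * (16 / 3 * (s - v) + v))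
    + b * ε ^ 3 / 8 * satPrim y₁
    + D ^ 2 / (400 * b) * ε ^ 2 * (s ^ 2 / 2 + 3 / 32 * v ^ 2 - 1 / 16 * (s * v))

lemma cross_sq_le (D ε s v : ℝ) :
    (D * ε ^ 3 * (16 / 3) * (16 / 3 * (s - v) + v)) ^ 2
      ≤ 1800 * D ^ 2 * ε ^ 6 * (s ^ 2 + v ^ 2) := by
  have h : ((16 / 3) * (16 / 3 * (s - v) + v)) ^ 2 ≤ 1800 * (s ^ 2 + v ^ 2) := by
    nlinarith [sq_nonneg (s + v), sq_nonneg s, sq_nonneg v]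
  have := mul_le_mul_of_nonneg_left h (by positivity : 0 ≤ D ^ 2 * (ε ^ 3) ^ 2)
  linear_combination this

lemma outerLyap_lower {D b ε : ℝ} (hb : 0 < b) (hb1 : b ≤ 1) (hε : 0 < ε) (hε1 : ε ≤ 1)
    (hε2 : 50000000 * ε ≤ 1) (y₁ y₂ s v : ℝ) :
    (y₁ ^ 2 + y₂ ^ 2) / 4 + D ^ 2 / (400 * b) * ε ^ 2 / 64 * (s ^ 2 + v ^ 2)
      ≤ outerLyap D b ε y₁ y₂ s v := by
  unfold outerLyap
  have hX := cross_sq_le D ε s v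
  set X := D * ε ^ 3 * (16 / 3) * (16 / 3 * (s - v) + v)
  have h1 : -(y₂ ^ 2 / 4 + X ^ 2) ≤ y₂ * X := by nlinarith [sq_nonneg (y₂ / 2 + X)]
  have h2 : 0 ≤ b * ε ^ 3 / 8 * satPrim y₁ :=
    mul_nonneg (by positivity) (by linarith [(satPrim_bounds y₁).1, sq_nonneg (sat y₁)])
  have h3 : (s ^ 2 + v ^ 2) / 32 ≤ s ^ 2 / 2 + 3 / 32 * v ^ 2 - 1 / 16 * (s * v) := by
    nlinarith [sq_nonneg (s - v), sq_nonneg s, sq_nonneg v]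
  have h4 := mul_le_mul_of_nonneg_left h3 (by positivity : 0 ≤ D ^ 2 / (400 * b) * ε ^ 2)
  have h5 : 1800 * D ^ 2 * ε ^ 6 * (s ^ 2 + v ^ 2)
      ≤ D ^ 2 / (400 * b) * ε ^ 2 / 64 * (s ^ 2 + v ^ 2) := by
    apply mul_le_mul_of_nonneg_right _ (by positivity)
    have h6 : 1800 * ε ^ 4 ≤ 1 / (400 * b) / 64 := by
      have : ε ^ 4 ≤ ε := pow_le_of_le_one hε.le hε1 (by norm_num)
      have hbε : b * ε ^ 4 ≤ ε := (mul_le_of_le_one_left (by positivity) hb1).trans this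
      rw [div_div, le_div_iff₀ (by positivity)]
      linarith
    have := mul_le_mul_of_nonneg_left h6 (by positivity : 0 ≤ D ^ 2 * ε ^ 2)
    linear_combination this
  linarith [sq_nonneg y₁]

lemma outerLyap_upper {D b ε : ℝ} (hb : 0 < b) (hb1 : b ≤ 1) (hε : 0 < ε) (hε1 : ε ≤ 1)
    (y₁ y₂ s v : ℝ) :
    outerLyap D b ε y₁ y₂ s v
      ≤ (2 + 900 * D ^ 2 + D ^ 2 / (400 * b)) * (y₁ ^ 2 + y₂ ^ 2 + (s ^ 2 + v ^ 2)) := by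
  unfold outerLyap
  have hX := cross_sq_le D ε s v
  set X := D * ε ^ 3 * (16 / 3) * (16 / 3 * (s - v) + v)
  have e1 : ε ^ 6 ≤ 1 := pow_le_one₀ hε.le hε1
  have e2 : ε ^ 2 ≤ 1 := pow_le_one₀ hε.le hε1
  have e3 : ε ^ 3 ≤ 1 := pow_le_one₀ hε.le hε1
  have hX' : 1800 * D ^ 2 * ε ^ 6 * (s ^ 2 + v ^ 2) ≤ 1800 * D ^ 2 * 1 * (s ^ 2 + v ^ 2) := by
    gcongr
  have h1 : y₂ * X ≤ y₂ ^ 2 / 2 + X ^ 2 / 2 := by nlinarith [sq_nonneg (y₂ - X)]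
  have h2 : b * ε ^ 3 / 8 * satPrim y₁ ≤ 1 * (y₁ ^ 2 / 2) := by
    refine mul_le_mul ?_ (satPrim_bounds y₁).2
      (by linarith [(satPrim_bounds y₁).1, sq_nonneg (sat y₁)]) zero_le_one
    have := mul_le_one₀ hb1 (by positivity) e3
    linarith
  have h3 : s ^ 2 / 2 + 3 / 32 * v ^ 2 - 1 / 16 * (s * v) ≤ s ^ 2 + v ^ 2 := by
    nlinarith [sq_nonneg (s + v), sq_nonneg s, sq_nonneg v]
  have h4 : D ^ 2 / (400 * b) * ε ^ 2 * (s ^ 2 / 2 + 3 / 32 * v ^ 2 - 1 / 16 * (s * v))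
      ≤ D ^ 2 / (400 * b) * 1 * (s ^ 2 + v ^ 2) := by
    refine mul_le_mul (by gcongr) h3 ?_ (by positivity)
    nlinarith [sq_nonneg (s - v), sq_nonneg s, sq_nonneg v]
  have p1 : 0 ≤ D ^ 2 * (y₁ ^ 2 + y₂ ^ 2) := by positivity
  have p2 : 0 ≤ D ^ 2 / (400 * b) * (y₁ ^ 2 + y₂ ^ 2) := by positivity
  linarith [sq_nonneg y₁, sq_nonneg y₂, sq_nonneg s, sq_nonneg v]

lemma outer_rate_le {y₁ y₂ s v κ κm D b ε k : ℝ} (hs : |s| ≤ 1 / 2) (hv : |v| ≤ 1)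
    (hκ : |κ| ≤ κm) (hD : 0 < D) (hb : 0 < b) (hb1 : b ≤ 1)
    (hε : 0 < ε) (hε1 : ε ≤ 1) (hkε : k * ε = 1)
    (hE1 : (1000 * D ^ 2 + 200 * D * κm + κm * b ^ 2 + κm ^ 2 * b + 5 * b * D ^ 2) * ε
      ≤ 3 / 256 * b)
    (hE2 : (1000 * D ^ 2 + 200 * D * κm + κm * b ^ 2 + κm ^ 2 * b + 5 * b * D ^ 2) * ε
      ≤ D ^ 2 / (400 * b) / 512)
    {ξ Y₁ Y₂ S V d₁ d₂ : ℝ} (hξ : ξ = 16 / 3 * D * ε ^ 2 * (s - v))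
    (hd₁ : d₁ = -(κ * (3 / 128 * b * ε / D) * sat y₁))
    (hd₂ : d₂ = b * ε / (2 * D) * sat y₂)
    (hY₁ : Y₁ = -(3 / 128 * b * ε ^ 2) * sat y₁ + (Real.cos ξ - 1)
      + κ * (1 + 3 / 128 * b * ε ^ 2 * sat y₁) * y₂)
    (hY₂ : Y₂ = Real.sin ξ - κ * (1 + 3 / 128 * b * ε ^ 2 * sat y₁) * y₁)
    (hS : S = k * (3 / 16 * v + 3 / 16 * d₁ - (s + d₂))) (hV : V = k * -(s + d₂)) :
    y₁ * Y₁ + y₂ * Y₂ + (Y₂ * (D * ε ^ 3 * (16 / 3) * (16 / 3 * (s - v) + v))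
        + y₂ * (D * ε ^ 3 * (16 / 3) * (16 / 3 * (S - V) + V)))
      + b * ε ^ 3 / 8 * (sat y₁ * Y₁)
      + D ^ 2 / (400 * b) * ε ^ 2 * ((s - v / 16) * S + (3 / 16 * v - s / 16) * V)
    ≤ -(3 / 256 * b * ε ^ 2) * (y₁ * sat y₁) - b * ε ^ 3 * (y₂ * sat y₂)
      - D ^ 2 / (400 * b) / 512 * ε * (s ^ 2 + v ^ 2) := by
  have hκm : 0 ≤ κm := (abs_nonneg _).trans hκ
  have hA1 := mul_sat_nonneg y₁
  have hA2 := mul_sat_nonneg y₂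
  have hn0 : 0 ≤ |s| + |v| := by positivity
  have hnN : (|s| + |v|) ^ 2 ≤ 2 * (s ^ 2 + v ^ 2) := by
    nlinarith [sq_nonneg (|s| - |v|), sq_abs s, sq_abs v]
  have hsv : |s - v| ≤ |s| + |v| := abs_sub _ _
  have hξb : |ξ| ≤ 6 * D * (|s| + |v|) * ε ^ 2 := by
    rw [hξ, abs_mul, abs_of_pos (by positivity)]
    calc 16 / 3 * D * ε ^ 2 * |s - v| ≤ 6 * D * ε ^ 2 * (|s| + |v|) := by gcongr; norm_num
      _ = _ := by ring
  have hXb : |D * ε ^ 3 * (16 / 3) * (16 / 3 * (s - v) + v)|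
      ≤ 30 * D * (|s| + |v|) * ε ^ 3 := by
    rw [abs_mul, abs_of_pos (by positivity)]
    have : |16 / 3 * (s - v) + v| ≤ 16 / 3 * (|s| + |v|) := by
      rw [abs_le]
      constructor <;> linarith [neg_abs_le s, neg_abs_le v, le_abs_self s, le_abs_self v]
    calc _ ≤ D * ε ^ 3 * (16 / 3) * (16 / 3 * (|s| + |v|)) := by gcongr
      _ ≤ D * ε ^ 3 * 30 * (|s| + |v|) := by
        have : 0 ≤ D * ε ^ 3 * (|s| + |v|) := by positivity
        linarith
      _ = _ := by ring
  have hpos := position_error_le (y₁ := y₁) (y₂ := y₂) hn0 (by linarith) hnN hκ hD hb hb1 hε hε1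
    hξb hXb
  have hlin := mul_le_mul_of_nonneg_left (linear_rate_le s v d₁ d₂)
    (by positivity : 0 ≤ D ^ 2 / (400 * b) * ε)
  have hd₁sq : D ^ 2 / (400 * b) * ε * (400 * d₁ ^ 2) ≤ κm ^ 2 * b * ε ^ 3 * (y₁ * sat y₁) := by
    have hκ2 : κ ^ 2 ≤ κm ^ 2 := sq_le_sq' (by linarith [neg_abs_le κ]) (by linarith [le_abs_self κ])
    have : D ^ 2 / (400 * b) * ε * (400 * d₁ ^ 2)
        = 9 / 16384 * (κ ^ 2 * b * ε ^ 3 * sat y₁ ^ 2) := by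
      rw [hd₁]; field_simp; ring
    rw [this]
    have h2 : κ ^ 2 * b * ε ^ 3 * sat y₁ ^ 2 ≤ κm ^ 2 * b * ε ^ 3 * (y₁ * sat y₁) := by
      gcongr; exact sat_sq_le y₁
    have h3 : 0 ≤ κm ^ 2 * b * ε ^ 3 * (y₁ * sat y₁) := by positivity
    linarith
  have hd₂sq : D ^ 2 / (400 * b) * ε * (400 * d₂ ^ 2) ≤ b / 4 * ε ^ 3 * (y₂ * sat y₂) := by
    have : D ^ 2 / (400 * b) * ε * (400 * d₂ ^ 2) = b / 4 * ε ^ 3 * sat y₂ ^ 2 := by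
      rw [hd₂]; field_simp; ring
    rw [this]
    gcongr; exact sat_sq_le y₂
  have hN : 0 ≤ s ^ 2 + v ^ 2 := by positivity
  have q1 := mul_le_mul_of_nonneg_right hE1 (by positivity : 0 ≤ ε ^ 2 * (y₁ * sat y₁))
  have q2 := mul_le_mul_of_nonneg_right hE1 (by positivity : 0 ≤ ε ^ 3 * (y₂ * sat y₂))
  have q3 := mul_le_mul_of_nonneg_right hE2 (by positivity : 0 ≤ ε * (s ^ 2 + v ^ 2))
  have hid : y₁ * Y₁ + y₂ * Y₂ + (Y₂ * (D * ε ^ 3 * (16 / 3) * (16 / 3 * (s - v) + v))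
        + y₂ * (D * ε ^ 3 * (16 / 3) * (16 / 3 * (S - V) + V)))
      + b * ε ^ 3 / 8 * (sat y₁ * Y₁)
      + D ^ 2 / (400 * b) * ε ^ 2 * ((s - v / 16) * S + (3 / 16 * v - s / 16) * V)
      = (y₁ * (Real.cos ξ - 1) + y₂ * (Real.sin ξ - ξ)
      + (Real.sin ξ - κ * (1 + 3 / 128 * b * ε ^ 2 * sat y₁) * y₁)
        * (D * ε ^ 3 * (16 / 3) * (16 / 3 * (s - v) + v))
      + b * ε ^ 3 / 8 * (sat y₁ * (Real.cos ξ - 1)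
        + κ * (3 / 128 * b * ε ^ 2) * sat y₁ ^ 2 * y₂))
      + D ^ 2 / (400 * b) * ε * ((s - v / 16) * (3 / 16 * v + 3 / 16 * d₁ - (s + d₂))
        + (3 / 16 * v - s / 16) * -(s + d₂))
      - 3 / 128 * b * ε ^ 2 * (y₁ * sat y₁) - 8 / 3 * b * ε ^ 3 * (y₂ * sat y₂)
      - b * ε ^ 3 / 8 * (3 / 128 * b * ε ^ 2) * sat y₁ ^ 2 := by
    have hcross : D * ε ^ 3 * (16 / 3) * (16 / 3 * (S - V) + V)
        = -ξ - κ * b * ε ^ 3 / 8 * sat y₁ - 8 / 3 * b * ε ^ 3 * sat y₂ := by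
      have h1 : D * ε ^ 3 * (16 / 3) * (16 / 3 * (S - V) + V)
          = k * ε * (D * ε ^ 2 * (16 / 3) * (v + d₁ - s - d₂)) := by
        rw [hS, hV]; ring
      have h2 : D * d₁ = -(κ * (3 / 128 * b * ε) * sat y₁) := by rw [hd₁]; field_simp
      have h3 : D * d₂ = b * ε / 2 * sat y₂ := by rw [hd₂]; field_simp
      rw [h1, hkε, hξ]
      linear_combination (16 / 3 * ε ^ 2) * h2 - (16 / 3 * ε ^ 2) * h3
    rw [hcross, hS, hV, hY₁, hY₂]
    linear_combination (D ^ 2 / (400 * b) * ε * ((s - v / 16) * (3 / 16 * v + 3 / 16 * d₁ - (s + d₂))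
        + (3 / 16 * v - s / 16) * -(s + d₂))) * hkε
  rw [hid]
  have r0 : 0 ≤ b * ε ^ 3 / 8 * (3 / 128 * b * ε ^ 2) * sat y₁ ^ 2 := by positivity
  have r1 : 0 ≤ (928 * D ^ 2 + 80 * D * κm + 5 * b * D ^ 2) * (ε ^ 3 * (y₁ * sat y₁)) := by
    positivity
  have r2 : 0 ≤ (856 * D ^ 2 + 200 * D * κm + κm ^ 2 * b + 5 * b * D ^ 2)
      * (ε ^ 4 * (y₂ * sat y₂)) := by positivity
  have r3 : 0 ≤ (500 * D ^ 2 + 140 * D * κm + κm * b ^ 2 + κm ^ 2 * b)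
      * (ε ^ 2 * (s ^ 2 + v ^ 2)) := by positivity
  have r4 : 0 ≤ b * ε ^ 3 * (y₂ * sat y₂) := by positivity
  linear_combination hpos + hlin + hd₁sq + hd₂sq + q1 + q2 + q3 + r0 + r1 + r2 + r3
    + (8 / 3 - 1 / 4 - 1 - 3 / 256) * r4

lemma sq_le_mul_sat {y R : ℝ} (hR : 1 ≤ R) (hy : |y| ≤ R) : y ^ 2 ≤ R * (y * sat y) := by
  obtain ⟨h1, h2⟩ := abs_le.1 hy
  rcases sat_cases y with ⟨_, _, h⟩ | ⟨_, h⟩ | ⟨_, h⟩ <;> rw [h] <;> nlinarith [sq_nonneg y]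

lemma tendsto_zero_of_sq_le {f g : ℝ → ℝ} {C T : ℝ}
    (hf : Filter.Tendsto f Filter.atTop (nhds 0)) (h : ∀ t ≥ T, g t ^ 2 ≤ C * f t) :
    Filter.Tendsto g Filter.atTop (nhds 0) := by
  have hsq : Filter.Tendsto (fun t => Real.sqrt (C * f t)) Filter.atTop (nhds 0) := by
    simpa using (hf.const_mul C).sqrt
  refine squeeze_zero_norm' ?_ hsq
  filter_upwards [Filter.eventually_ge_atTop T] with t ht
  exact Real.abs_le_sqrt (h t ht)

/-- Convergence of the closed loop from the time at which the inner saturation is inactive. -/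
lemma outer_tendsto {y₁ y₂ s v κ ξ Y₁ Y₂ S V d₁ d₂ : ℝ → ℝ} {κm D b ε k T : ℝ}
    (hD : 0 < D) (hb : 0 < b) (hb1 : b ≤ 1)
    (hε : 0 < ε) (hε1 : ε ≤ 1) (hkε : k * ε = 1) (hε2 : 50000000 * ε ≤ 1)
    (hE1 : (1000 * D ^ 2 + 200 * D * κm + κm * b ^ 2 + κm ^ 2 * b + 5 * b * D ^ 2) * ε
      ≤ 3 / 256 * b)
    (hE2 : (1000 * D ^ 2 + 200 * D * κm + κm * b ^ 2 + κm ^ 2 * b + 5 * b * D ^ 2) * ε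
      ≤ D ^ 2 / (400 * b) / 512)
    (hs : ∀ t ≥ T, |s t| ≤ 1 / 2) (hv : ∀ t ≥ T, |v t| ≤ 1) (hκ : ∀ t ≥ T, |κ t| ≤ κm)
    (hξ : ∀ t, ξ t = 16 / 3 * D * ε ^ 2 * (s t - v t))
    (hd₁ : ∀ t, d₁ t = -(κ t * (3 / 128 * b * ε / D) * sat (y₁ t)))
    (hd₂ : ∀ t, d₂ t = b * ε / (2 * D) * sat (y₂ t))
    (hY₁ : ∀ t, Y₁ t = -(3 / 128 * b * ε ^ 2) * sat (y₁ t) + (Real.cos (ξ t) - 1)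
      + κ t * (1 + 3 / 128 * b * ε ^ 2 * sat (y₁ t)) * y₂ t)
    (hY₂ : ∀ t, Y₂ t = Real.sin (ξ t) - κ t * (1 + 3 / 128 * b * ε ^ 2 * sat (y₁ t)) * y₁ t)
    (hS : ∀ t ≥ T, S t = k * (3 / 16 * v t + 3 / 16 * d₁ t - (s t + d₂ t)))
    (hV : ∀ t ≥ T, V t = k * -(s t + d₂ t))
    (hy₁' : ∀ t ≥ T, HasDerivWithinAt y₁ (Y₁ t) (Set.Ici T) t)
    (hy₂' : ∀ t ≥ T, HasDerivWithinAt y₂ (Y₂ t) (Set.Ici T) t)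
    (hs' : ∀ t ≥ T, HasDerivWithinAt s (S t) (Set.Ici T) t)
    (hv' : ∀ t ≥ T, HasDerivWithinAt v (V t) (Set.Ici T) t) :
    Filter.Tendsto y₁ Filter.atTop (nhds 0) ∧ Filter.Tendsto y₂ Filter.atTop (nhds 0) ∧
      Filter.Tendsto s Filter.atTop (nhds 0) ∧ Filter.Tendsto v Filter.atTop (nhds 0) := by
  set L : ℝ → ℝ := fun t => outerLyap D b ε (y₁ t) (y₂ t) (s t) (v t) with hL
  set L' : ℝ → ℝ := fun t => y₁ t * Y₁ t + y₂ t * Y₂ t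
      + (Y₂ t * (D * ε ^ 3 * (16 / 3) * (16 / 3 * (s t - v t) + v t))
        + y₂ t * (D * ε ^ 3 * (16 / 3) * (16 / 3 * (S t - V t) + V t)))
      + b * ε ^ 3 / 8 * (sat (y₁ t) * Y₁ t)
      + D ^ 2 / (400 * b) * ε ^ 2
        * ((s t - v t / 16) * S t + (3 / 16 * v t - s t / 16) * V t) with hL'
  have hderiv : ∀ t ≥ T, HasDerivWithinAt L (L' t) (Set.Ici T) t := by
    intro t ht
    have a1 := ((hy₁' t ht).pow 2 |>.add ((hy₂' t ht).pow 2)).div_const 2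
    have a2 := (hy₂' t ht).mul (((((hs' t ht).sub (hv' t ht)).const_mul (16 / 3 : ℝ)).add
      (hv' t ht)).const_mul (D * ε ^ 3 * (16 / 3)))
    have a3 := ((hasDerivAt_satPrim (y₁ t)).comp_hasDerivWithinAt t (hy₁' t ht)).const_mul
      (b * ε ^ 3 / 8)
    have a4 := (((((hs' t ht).pow 2).div_const 2).add
      (((hv' t ht).pow 2).const_mul (3 / 32 : ℝ))).sub
      (((hs' t ht).mul (hv' t ht)).const_mul (1 / 16 : ℝ))).const_mul
      (D ^ 2 / (400 * b) * ε ^ 2)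
    refine (((a1.add a2).add a3).add a4).congr_deriv ?_
    simp only [hL', Pi.add_apply, Pi.sub_apply]
    ring
  have hrate : ∀ t ≥ T, L' t ≤ -(3 / 256 * b * ε ^ 2) * (y₁ t * sat (y₁ t))
      - b * ε ^ 3 * (y₂ t * sat (y₂ t))
      - D ^ 2 / (400 * b) / 512 * ε * (s t ^ 2 + v t ^ 2) := fun t ht =>
    outer_rate_le (hs t ht) (hv t ht) (hκ t ht) hD hb hb1 hε hε1 hkε hE1 hE2 (hξ t) (hd₁ t)
      (hd₂ t) (hY₁ t) (hY₂ t) (hS t ht) (hV t ht)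
  have hlow : ∀ t, (y₁ t ^ 2 + y₂ t ^ 2) / 4
      + D ^ 2 / (400 * b) * ε ^ 2 / 64 * (s t ^ 2 + v t ^ 2) ≤ L t := fun t =>
    outerLyap_lower hb hb1 hε hε1 hε2 _ _ _ _
  have hpos : ∀ t, 0 ≤ L t := fun t => le_trans (by positivity) (hlow t)
  have hμ : 0 < D ^ 2 / (400 * b) * ε ^ 2 / 64 := by positivity
  have hLT : ∀ t ≥ T, L t ≤ L T := by
    refine le_of_deriv_nonpos hderiv fun t ht => (hrate t ht).trans ?_
    have h1 := mul_nonneg (by positivity : 0 ≤ 3 / 256 * b * ε ^ 2) (mul_sat_nonneg (y₁ t))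
    have h2 := mul_nonneg (by positivity : 0 ≤ b * ε ^ 3) (mul_sat_nonneg (y₂ t))
    have h3 : 0 ≤ D ^ 2 / (400 * b) / 512 * ε * (s t ^ 2 + v t ^ 2) := by positivity
    linarith
  set R := 1 + 4 * L T with hR
  have hR1 : 1 ≤ R := by linarith [hpos T]
  have hR0 : 0 < R := by linarith
  have hyR : ∀ t ≥ T, |y₁ t| ≤ R ∧ |y₂ t| ≤ R := by
    intro t ht
    have h1 := hLT t ht
    have h2 := hlow t
    have h3 : 0 ≤ D ^ 2 / (400 * b) * ε ^ 2 / 64 * (s t ^ 2 + v t ^ 2) := by positivity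
    constructor <;> refine abs_le_of_sq_le_sq ?_ hR0.le <;>
      nlinarith [sq_nonneg (y₁ t), sq_nonneg (y₂ t), hpos T]
  obtain ⟨q, hq, hq1, hq2, hq3⟩ : ∃ q > 0, q ≤ 3 / 256 * b * ε ^ 2 ∧ q ≤ b * ε ^ 3 ∧
      q ≤ D ^ 2 / (400 * b) / 512 * ε :=
    ⟨min (min (3 / 256 * b * ε ^ 2) (b * ε ^ 3)) (D ^ 2 / (400 * b) / 512 * ε),
      by simp only [gt_iff_lt, lt_min_iff]; refine ⟨⟨?_, ?_⟩, ?_⟩ <;> positivity,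
      (min_le_left _ _).trans (min_le_left _ _), (min_le_left _ _).trans (min_le_right _ _),
      min_le_right _ _⟩
  set C := 2 + 900 * D ^ 2 + D ^ 2 / (400 * b) with hC
  have hC0 : 0 < C := by positivity
  have hdec : ∀ t ≥ T, L' t ≤ -(q / (R * C)) * L t := by
    intro t ht
    have hA1 := mul_sat_nonneg (y₁ t)
    have hA2 := mul_sat_nonneg (y₂ t)
    have hN : 0 ≤ s t ^ 2 + v t ^ 2 := by positivity
    have h1 : L' t ≤ -q * (y₁ t * sat (y₁ t) + y₂ t * sat (y₂ t) + (s t ^ 2 + v t ^ 2)) := by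
      have := hrate t ht
      have := mul_le_mul_of_nonneg_right hq1 hA1
      have := mul_le_mul_of_nonneg_right hq2 hA2
      have := mul_le_mul_of_nonneg_right hq3 hN
      linarith
    have h2 : L t ≤ R * C
        * (y₁ t * sat (y₁ t) + y₂ t * sat (y₂ t) + (s t ^ 2 + v t ^ 2)) := by
      have hup : L t ≤ C * (y₁ t ^ 2 + y₂ t ^ 2 + (s t ^ 2 + v t ^ 2)) :=
        outerLyap_upper hb hb1 hε hε1 _ _ _ _
      refine hup.trans ?_
      rw [mul_comm R C, mul_assoc]
      refine mul_le_mul_of_nonneg_left ?_ hC0.le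
      have := sq_le_mul_sat hR1 (hyR t ht).1
      have := sq_le_mul_sat hR1 (hyR t ht).2
      have := le_mul_of_one_le_left hN hR1
      linarith
    refine h1.trans ?_
    have h3 := mul_le_mul_of_nonneg_left h2 (by positivity : 0 ≤ q / (R * C))
    have h4 : q / (R * C) * (R * C
        * (y₁ t * sat (y₁ t) + y₂ t * sat (y₂ t) + (s t ^ 2 + v t ^ 2)))
        = q * (y₁ t * sat (y₁ t) + y₂ t * sat (y₂ t) + (s t ^ 2 + v t ^ 2)) := by
      field_simp
    linarith
  have hlim : Filter.Tendsto L Filter.atTop (nhds 0) :=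
    tendsto_zero_of_deriv_le_neg_mul (by positivity) hderiv (fun t _ => hpos t) hdec
  have hsv : ∀ t, s t ^ 2 + v t ^ 2 ≤ (D ^ 2 / (400 * b) * ε ^ 2 / 64)⁻¹ * L t := by
    intro t
    rw [inv_mul_eq_div, le_div_iff₀ hμ]
    linarith [hlow t, sq_nonneg (y₁ t), sq_nonneg (y₂ t)]
  have hyy : ∀ t, y₁ t ^ 2 + y₂ t ^ 2 ≤ 4 * L t := by
    intro t
    have : 0 ≤ D ^ 2 / (400 * b) * ε ^ 2 / 64 * (s t ^ 2 + v t ^ 2) := by positivity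
    linarith [hlow t]
  exact ⟨tendsto_zero_of_sq_le (C := 4) (T := T) hlim fun t _ => by
      linarith [hyy t, sq_nonneg (y₂ t)],
    tendsto_zero_of_sq_le (C := 4) (T := T) hlim fun t _ => by
      linarith [hyy t, sq_nonneg (y₁ t)],
    tendsto_zero_of_sq_le (C := (D ^ 2 / (400 * b) * ε ^ 2 / 64)⁻¹) (T := T) hlim fun t _ => by
      linarith [hsv t, sq_nonneg (v t)],
    tendsto_zero_of_sq_le (C := (D ^ 2 / (400 * b) * ε ^ 2 / 64)⁻¹) (T := T) hlim fun t _ => by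
      linarith [hsv t, sq_nonneg (s t)]⟩

/-- Finitely many smallness conditions hold for all small enough parameters. -/
lemma exists_gain_threshold (κm D b : ℝ) (hD : 0 < D) (hb : 0 < b) :
    ∃ K ≥ (1 : ℝ), ∀ k ≥ K, 50000000 * (1 / k) ≤ 1 ∧
      (1000 * D ^ 2 + 200 * D * κm + κm * b ^ 2 + κm ^ 2 * b + 5 * b * D ^ 2) * (1 / k)
        ≤ 3 / 256 * b ∧
      (1000 * D ^ 2 + 200 * D * κm + κm * b ^ 2 + κm ^ 2 * b + 5 * b * D ^ 2) * (1 / k)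
        ≤ D ^ 2 / (400 * b) / 512 ∧
      (κm * (3 / 128 * b / D)) * (1 / k) ≤ 1 / 10000 ∧ b / (2 * D) * (1 / k) ≤ 1 / 10000 := by
  have key : ∀ A B : ℝ, 0 < B → ∀ᶠ k : ℝ in Filter.atTop, A * (1 / k) ≤ B := by
    intro A B hB
    have : Filter.Tendsto (fun k : ℝ => A * (1 / k)) Filter.atTop (nhds 0) := by
      simpa using tendsto_inv_atTop_zero.const_mul A
    exact this.eventually (eventually_le_nhds hB)
  have h := (key 50000000 1 one_pos).and <|
    (key (1000 * D ^ 2 + 200 * D * κm + κm * b ^ 2 + κm ^ 2 * b + 5 * b * D ^ 2) (3 / 256 * b)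
      (by positivity)).and <|
    (key (1000 * D ^ 2 + 200 * D * κm + κm * b ^ 2 + κm ^ 2 * b + 5 * b * D ^ 2)
      (D ^ 2 / (400 * b) / 512) (by positivity)).and <|
    (key (κm * (3 / 128 * b / D)) (1 / 10000) (by norm_num)).and
    (key (b / (2 * D)) (1 / 10000) (by norm_num))
  obtain ⟨K, hK⟩ := Filter.eventually_atTop.1 h
  exact ⟨max 1 K, le_max_left _ _, fun k hk => hK k ((le_max_right _ _).trans hk)⟩


theorem closed_loop_global_convergence (κmax : ℝ) (hκmax : 0 < κmax) (κr : ℝ → ℝ)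
    (hκcont : ContinuousOn κr (Set.Ici 0))
    (hκbdd : ∀ t ≥ (0:ℝ), |κr t| ≤ κmax)
    (β D : ℝ) (hβ : 8 < β) (hD : 0 < D) :
    ∃ K > (0:ℝ), ∀ k₂ ≥ K,
      let a : ℝ := 3/16
      let k₁ : ℝ := a * k₂ ^ 2
      let C₂ : ℝ := 1 / (2 * β * k₂)
      let C₁ : ℝ := a * C₂ / (4 * k₂)
      ∀ y₁ y₂ ξ η : ℝ → ℝ,
        (∀ t ≥ (0:ℝ),
          HasDerivWithinAt y₁
            (-C₁ * sat (y₁ t) + (Real.cos (ξ t) - 1)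
              + κr t * (1 + C₁ * sat (y₁ t)) * y₂ t) (Set.Ici 0) t ∧
          HasDerivWithinAt y₂
            (Real.sin (ξ t) - κr t * (1 + C₁ * sat (y₁ t)) * y₁ t) (Set.Ici 0) t ∧
          HasDerivWithinAt ξ
            (η t - κr t * (C₁ * sat (y₁ t))) (Set.Ici 0) t ∧
          HasDerivWithinAt η
            (-D * sat ((k₁ / D) * ξ t + (k₂ / D) * η t + (C₂ / D) * sat (y₂ t)))
            (Set.Ici 0) t) →
        (Filter.Tendsto y₁ Filter.atTop (nhds 0) ∧
         Filter.Tendsto y₂ Filter.atTop (nhds 0) ∧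
         Filter.Tendsto ξ Filter.atTop (nhds 0) ∧
         Filter.Tendsto η Filter.atTop (nhds 0)) := by
  have hb : 0 < 1 / β := by positivity
  have hb1 : 1 / β ≤ 1 := by rw [div_le_one (by linarith)]; linarith
  obtain ⟨K, hK1, hK⟩ := exists_gain_threshold κmax D (1 / β) hD hb
  refine ⟨K, by linarith, ?_⟩
  intro k hk a k₁ C₂ C₁ y₁ y₂ ξ η hsol
  obtain ⟨hε2, hE1, hE2, hδ₁, hδ₂⟩ := hK k hk
  have hk1 : 1 ≤ k := hK1.trans hk
  have hk0 : 0 < k := by linarith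
  have hβ0 : 0 < β := by linarith
  set b := 1 / β with hbdef
  set ε := 1 / k with hεdef
  have hε : 0 < ε := by positivity
  have hε1 : ε ≤ 1 := by rw [hεdef, div_le_one hk0]; exact hk1
  have hkε : k * ε = 1 := by rw [hεdef]; field_simp
  have hk₁ : k₁ = 3 / 16 * k ^ 2 := rfl
  have hC₂ : C₂ = b * ε / 2 := by
    change 1 / (2 * β * k) = _
    rw [hbdef, hεdef]; field_simp
  have hC₁ : C₁ = 3 / 128 * b * ε ^ 2 := by
    change 3 / 16 * (1 / (2 * β * k)) / (4 * k) = _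
    rw [hbdef, hεdef]; field_simp; norm_num
  set s : ℝ → ℝ := fun t => k₁ / D * ξ t + k / D * η t with hsdef
  set v : ℝ → ℝ := fun t => k / D * η t with hvdef
  set d₁ : ℝ → ℝ := fun t => -(κr t * (3 / 128 * b * ε / D) * sat (y₁ t)) with hd₁def
  set d₂ : ℝ → ℝ := fun t => b * ε / (2 * D) * sat (y₂ t) with hd₂def
  have hC₂d : ∀ t, C₂ / D * sat (y₂ t) = d₂ t := fun t => by
    simp only [hd₂def, hC₂]; field_simp
  have hv' : ∀ t ≥ (0 : ℝ), HasDerivWithinAt v (k * -sat (s t + d₂ t)) (Set.Ici 0) t := by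
    intro t ht
    refine ((hsol t ht).2.2.2.const_mul (k / D)).congr_deriv ?_
    rw [hC₂d]
    simp only [hsdef]
    field_simp
  have hs' : ∀ t ≥ (0 : ℝ), HasDerivWithinAt s
      (k * (3 / 16 * v t + 3 / 16 * d₁ t - sat (s t + d₂ t))) (Set.Ici 0) t := by
    intro t ht
    refine (((hsol t ht).2.2.1.const_mul (k₁ / D)).add (hv' t ht)).congr_deriv ?_
    have h1 : k₁ / D * (η t - κr t * (C₁ * sat (y₁ t)))
        = k * (3 / 16 * v t + 3 / 16 * d₁ t) := by
      simp only [hvdef, hd₁def, hk₁, hC₁]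
      have : k ^ 2 * ε ^ 2 = k * ε := by rw [← mul_pow, hkε]; norm_num
      linear_combination -(3 / 16 / D * κr t * (3 / 128) * b * sat (y₁ t)) * this
    rw [h1]; ring
  have hd₁b : ∀ t ≥ (0 : ℝ), |d₁ t| ≤ 1 / 10000 := by
    intro t ht
    simp only [hd₁def]
    rw [abs_neg, abs_mul, abs_mul, abs_of_pos (by positivity : 0 < 3 / 128 * b * ε / D)]
    calc |κr t| * (3 / 128 * b * ε / D) * |sat (y₁ t)|
        ≤ κmax * (3 / 128 * b * ε / D) * 1 := by
          gcongr
          · exact hκbdd t ht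
          · exact abs_sat_le_one _
      _ = κmax * (3 / 128 * b / D) * ε := by ring
      _ ≤ _ := hδ₁
  have hd₂b : ∀ t ≥ (0 : ℝ), |d₂ t| ≤ 1 / 10000 := by
    intro t _
    simp only [hd₂def]
    rw [abs_mul, abs_of_pos (by positivity : 0 < b * ε / (2 * D))]
    calc b * ε / (2 * D) * |sat (y₂ t)| ≤ b * ε / (2 * D) * 1 := by
          gcongr
          exact abs_sat_le_one _
      _ = b / (2 * D) * ε := by ring
      _ ≤ _ := hδ₂
  obtain ⟨T, hT0, hT⟩ := inner_eventually_bounded hk0 hs' hv' hd₁b hd₂b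
  have hlin : ∀ t ≥ T, sat (s t + d₂ t) = s t + d₂ t := by
    intro t ht
    have h1 := abs_le.1 (hT t ht).1
    have h2 := abs_le.1 (hd₂b t (hT0.trans ht))
    rcases sat_cases (s t + d₂ t) with ⟨_, _, h⟩ | ⟨_, _⟩ | ⟨_, _⟩
    · exact h
    · linarith
    · linarith
  have hξs : ∀ t, ξ t = 16 / 3 * D * ε ^ 2 * (s t - v t) := by
    intro t
    simp only [hsdef, hvdef, hk₁, hεdef]
    field_simp
    ring
  have hηv : ∀ t, η t = D * ε * v t := by
    intro t
    simp only [hvdef, hεdef]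
    field_simp
  have hsub : Set.Ici T ⊆ Set.Ici (0 : ℝ) := Set.Ici_subset_Ici.2 hT0
  obtain ⟨r1, r2, r3, r4⟩ := outer_tendsto (y₁ := y₁) (y₂ := y₂) (s := s) (v := v) (κ := κr)
    (ξ := ξ) (κm := κmax) (T := T)
    (d₁ := d₁) (d₂ := d₂) hD hb hb1 hε hε1 hkε hε2 hE1 hE2
    (fun t ht => (hT t ht).1) (fun t ht => (hT t ht).2) (fun t ht => hκbdd t (hT0.trans ht))
    hξs (fun _ => rfl) (fun _ => rfl) (fun _ => rfl) (fun _ => rfl)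
    (S := fun t => k * (3 / 16 * v t + 3 / 16 * d₁ t - sat (s t + d₂ t)))
    (V := fun t => k * -sat (s t + d₂ t))
    (fun t ht => by rw [hlin t ht]) (fun t ht => by rw [hlin t ht])
    (fun t ht => ((hsol t (hT0.trans ht)).1.mono hsub).congr_deriv (by rw [hC₁]))
    (fun t ht => ((hsol t (hT0.trans ht)).2.1.mono hsub).congr_deriv (by rw [hC₁]))
    (fun t ht => (hs' t (hT0.trans ht)).mono hsub)
    (fun t ht => (hv' t (hT0.trans ht)).mono hsub)
  refine ⟨r1, r2, ?_, ?_⟩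
  · rw [funext hξs]
    simpa using (r3.sub r4).const_mul (16 / 3 * D * ε ^ 2)
  · rw [funext hηv]
    simpa using r4.const_mul (D * ε)
end

section
/- For k₂ ≥ 20 and k₁ = (3/16)k₂², the quantity λ := (1 + k₁² + k₂²)/2 − (1/2)·√((1 − k₁²)² + k₂²(k₂² + 2 + 2k₁²)) satisfies 0.93 < λ < 1. Consequently, the L₂-gain Υ_L := 1/√λ satisfies 1 < Υ_L < 1.2. -/
theorem l2_gain_bounds (k₁ k₂ : ℝ) (hk₂ : 20 ≤ k₂) (hk₁ : k₁ = (3/16) * k₂ ^ 2) :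
    let lam : ℝ := (1 + k₁ ^ 2 + k₂ ^ 2) / 2
      - (1/2) * Real.sqrt ((1 - k₁ ^ 2) ^ 2 + k₂ ^ 2 * (k₂ ^ 2 + 2 + 2 * k₁ ^ 2))
    0.93 < lam ∧ lam < 1 ∧ 1 < 1 / Real.sqrt lam ∧ 1 / Real.sqrt lam < 1.2 := by
  intro lam
  have hb : 400 ≤ k₂ ^ 2 := by nlinarith
  have ha : k₁ ^ 2 = 9 / 256 * (k₂ ^ 2) ^ 2 := by rw [hk₁]; ring
  have ha_nonneg : 0 ≤ k₁ ^ 2 := sq_nonneg k₁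
  have hupper : Real.sqrt ((1 - k₁ ^ 2) ^ 2 + k₂ ^ 2 * (k₂ ^ 2 + 2 + 2 * k₁ ^ 2))
      < 1 + k₁ ^ 2 + k₂ ^ 2 - 1.86 := by
    rw [Real.sqrt_lt' (by linarith)]
    have h : 3.72 * k₂ ^ 2 + 0.2604 < 0.28 * k₁ ^ 2 := by rw [ha]; nlinarith
    linear_combination h
  have hlower : 1 + k₁ ^ 2 + k₂ ^ 2 - 2
      < Real.sqrt ((1 - k₁ ^ 2) ^ 2 + k₂ ^ 2 * (k₂ ^ 2 + 2 + 2 * k₁ ^ 2)) := by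
    apply Real.lt_sqrt_of_sq_lt
    linear_combination (4 : ℝ) * (by linarith : 0 < k₂ ^ 2)
  have hgt : 0.93 < lam := by simp only [lam]; linarith
  have hlt : lam < 1 := by simp only [lam]; linarith
  have hsqrt_pos : 0 < Real.sqrt lam := Real.sqrt_pos.2 (by linarith)
  refine ⟨hgt, hlt, ?_, ?_⟩
  · rw [one_lt_div hsqrt_pos, Real.sqrt_lt' one_pos]
    linarith
  · have h : 1 / 1.2 < Real.sqrt lam := Real.lt_sqrt_of_sq_lt (by norm_num at hgt ⊢; linarith)
    exact (one_div_lt (by norm_num) hsqrt_pos).1 h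
end

section
/- Let k₂ ≥ 20 and k₁ = (3/16)k₂². For ω ∈ ℝ define λ(ω) := (1 + k₁² + k₂² + 2ω² − √((1 + k₁² + k₂² + 2ω²)² − 4(ω²k₂² + (ω² − k₁)²)))/2. Then the infimum over ω ∈ ℝ of λ(ω) is attained at ω = 0 and equals (1 + k₁² + k₂²)/2 − (1/2)·√((1 − k₁²)² + k₂²(k₂² + 2 + 2k₁²)). -/
theorem min_eigenvalue_attained_at_zero (k₁ k₂ : ℝ) (hk₂ : 20 ≤ k₂)
    (hk₁ : k₁ = (3/16) * k₂ ^ 2) :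
    let lam : ℝ → ℝ := fun ω =>
      (1 + k₁ ^ 2 + k₂ ^ 2 + 2 * ω ^ 2
        - Real.sqrt ((1 + k₁ ^ 2 + k₂ ^ 2 + 2 * ω ^ 2) ^ 2
            - 4 * (ω ^ 2 * k₂ ^ 2 + (ω ^ 2 - k₁) ^ 2))) / 2
    IsLeast (Set.range lam) (lam 0) ∧
    lam 0 = (1 + k₁ ^ 2 + k₂ ^ 2) / 2
      - (1/2) * Real.sqrt ((1 - k₁ ^ 2) ^ 2 + k₂ ^ 2 * (k₂ ^ 2 + 2 + 2 * k₁ ^ 2)) := by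
  intro lam
  set s := √((1 - k₁ ^ 2) ^ 2 + k₂ ^ 2 * (k₂ ^ 2 + 2 + 2 * k₁ ^ 2)) with hs
  have h0 : lam 0 = (1 + k₁ ^ 2 + k₂ ^ 2) / 2 - (1/2) * s := by
    have hD : (1 + k₁ ^ 2 + k₂ ^ 2 + 2 * (0 : ℝ) ^ 2) ^ 2
        - 4 * ((0 : ℝ) ^ 2 * k₂ ^ 2 + ((0 : ℝ) ^ 2 - k₁) ^ 2)
        = (1 - k₁ ^ 2) ^ 2 + k₂ ^ 2 * (k₂ ^ 2 + 2 + 2 * k₁ ^ 2) := by ring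
    simp only [lam, hD, ← hs]
    ring
  refine ⟨⟨⟨0, rfl⟩, ?_⟩, h0⟩
  rintro _ ⟨ω, rfl⟩
  have hs_nonneg : 0 ≤ s := Real.sqrt_nonneg _
  have hs_sq : s ^ 2 = (1 - k₁ ^ 2) ^ 2 + k₂ ^ 2 * (k₂ ^ 2 + 2 + 2 * k₁ ^ 2) :=
    Real.sq_sqrt (by positivity)
  have hs_lower : k₁ ^ 2 + k₂ ^ 2 - 1 ≤ s :=
    Real.le_sqrt_of_sq_le (by nlinarith [sq_nonneg k₂])
  have hk : 2 * k₁ + 2 ≤ k₂ ^ 2 := by nlinarith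
  have hsqrt : √((1 + k₁ ^ 2 + k₂ ^ 2 + 2 * ω ^ 2) ^ 2
      - 4 * (ω ^ 2 * k₂ ^ 2 + (ω ^ 2 - k₁) ^ 2)) ≤ s + 2 * ω ^ 2 := by
    refine Real.sqrt_le_iff.2 ⟨by positivity, ?_⟩
    have hgap : 0 ≤ ω ^ 2 * (s + ω ^ 2 - (1 + k₁ ^ 2 + 2 * k₁)) :=
      mul_nonneg (sq_nonneg ω) (by linarith [sq_nonneg ω])
    linear_combination 4 * hgap - hs_sq
  rw [h0]
  simp only [lam]
  linarith
end

section
/- Let a, β, l, k₂ > 0 and let V_k : ℝ² → ℝ satisfy V_k(ξ, η) ≥ l·(k₂ξ² + η²/k₂) for all ξ, η. Assume a·k₂²/2 > 1/(lβ). Then the function V(y₁, y₂, ξ, η) := βk₂·V_k(ξ, η) + (a·k₂²/2)(y₁² + y₂²) + η·y₂ + k₂·y₂·ξ satisfies V(y₁, y₂, ξ, η) ≥ (a·k₂²/2 − 1/(lβ))·y₂² + (lβk₂²/2)·ξ² + (lβ/2)·η² + (a·k₂²/2)·y₁² for all (y₁, y₂, ξ, η) ∈ ℝ⁴; in particular V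 is positive definite. -/
theorem lyapunov_positive_definite (a β l k₂ : ℝ) (ha : 0 < a) (hβ : 0 < β) (hl : 0 < l)
    (hk₂ : 0 < k₂) (Vk : ℝ → ℝ → ℝ)
    (hVk : ∀ ξ η : ℝ, Vk ξ η ≥ l * (k₂ * ξ ^ 2 + η ^ 2 / k₂))
    (hgap : a * k₂ ^ 2 / 2 > 1 / (l * β)) :
    (∀ y₁ y₂ ξ η : ℝ,
      β * k₂ * Vk ξ η + (a * k₂ ^ 2 / 2) * (y₁ ^ 2 + y₂ ^ 2) + η * y₂ + k₂ * y₂ * ξ ≥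
        (a * k₂ ^ 2 / 2 - 1 / (l * β)) * y₂ ^ 2 + (l * β * k₂ ^ 2 / 2) * ξ ^ 2
          + (l * β / 2) * η ^ 2 + (a * k₂ ^ 2 / 2) * y₁ ^ 2) ∧
    (∀ y₁ y₂ ξ η : ℝ, ¬ (y₁ = 0 ∧ y₂ = 0 ∧ ξ = 0 ∧ η = 0) →
      0 < β * k₂ * Vk ξ η + (a * k₂ ^ 2 / 2) * (y₁ ^ 2 + y₂ ^ 2) + η * y₂ + k₂ * y₂ * ξ) := by
  have hc : 0 < l * β := mul_pos hl hβ
  have bound : ∀ y₁ y₂ ξ η : ℝ,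
      β * k₂ * Vk ξ η + (a * k₂ ^ 2 / 2) * (y₁ ^ 2 + y₂ ^ 2) + η * y₂ + k₂ * y₂ * ξ ≥
        (a * k₂ ^ 2 / 2 - 1 / (l * β)) * y₂ ^ 2 + (l * β * k₂ ^ 2 / 2) * ξ ^ 2
          + (l * β / 2) * η ^ 2 + (a * k₂ ^ 2 / 2) * y₁ ^ 2 := by
    intro y₁ y₂ ξ η
    have hV : β * k₂ * (l * (k₂ * ξ ^ 2 + η ^ 2 / k₂)) ≤ β * k₂ * Vk ξ η :=
      mul_le_mul_of_nonneg_left (hVk ξ η) (mul_pos hβ hk₂).le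
    have hscale : β * k₂ * (l * (k₂ * ξ ^ 2 + η ^ 2 / k₂)) =
        l * β * (k₂ ^ 2 * ξ ^ 2 + η ^ 2) := by
      field_simp
    have hsquares : l * β / 2 * (k₂ * ξ + y₂ / (l * β)) ^ 2
          + l * β / 2 * (η + y₂ / (l * β)) ^ 2 =
        l * β / 2 * (k₂ ^ 2 * ξ ^ 2 + η ^ 2) + k₂ * y₂ * ξ + η * y₂
          + 1 / (l * β) * y₂ ^ 2 := by
      field_simp
      ring
    have hnonneg : 0 ≤ l * β / 2 * (k₂ * ξ + y₂ / (l * β)) ^ 2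
        + l * β / 2 * (η + y₂ / (l * β)) ^ 2 := by positivity
    linarith
  refine ⟨bound, fun y₁ y₂ ξ η hne => lt_of_lt_of_le ?_ (bound y₁ y₂ ξ η)⟩
  have hgap' : 0 < a * k₂ ^ 2 / 2 - 1 / (l * β) := sub_pos.mpr hgap
  by_cases h₁ : y₁ = 0
  · by_cases h₂ : y₂ = 0
    · by_cases h₃ : ξ = 0
      · have h₄ : η ≠ 0 := fun h₄ => hne ⟨h₁, h₂, h₃, h₄⟩
        positivity
      · positivity
    · positivity
  · positivity
end

section
/- Let d > 0 and κ_max ≥ 0 with d·κ_max < 1, let T ∈ (0, ∞], and let V_x, κ_r, η : [0, T) → ℝ be continuous functions with V_x(t) > 0, |κ_r(t)| ≤ κ_max for all t, and d·sup_{t∈[0,T)} |η(t)| < 1 − d·κ_max. Set ω := κ_r + η. Then there exists K > 0, depending only on d, κ_max and sup|η|, such that every differentiable function κ : [0, T) → ℝ satisfying d·κ̇(t) = V_x(t)·(1 + (d·κ(t))²)·(√(1 + (d·κ(t))²)·ω(t) − κ(t)) for all t ∈ [0, T) satisfies |κ(t)| ≤ max(|κ(0)|, K) for all t ∈ [0,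 T). In particular, κ does not blow up in finite time. -/
open scoped ENNReal

/-- A function on a compact interval starting below `M`, whose derivative is negative wherever it
takes the value `M`, stays below `M`. -/
theorem le_of_hasDerivWithinAt_neg_of_eq {f f' : ℝ → ℝ} {a b M : ℝ} (hab : a ≤ b)
    (hf : ∀ x ∈ Set.Icc a b, HasDerivWithinAt f (f' x) (Set.Icc a b) x) (ha : f a ≤ M)
    (hneg : ∀ x ∈ Set.Icc a b, f x = M → f' x < 0) : f b ≤ M := by
  refine image_le_of_deriv_right_lt_deriv_boundary' (f' := f') (B := fun _ => M)
    (B' := fun _ => 0) (fun x hx => (hf x hx).continuousWithinAt) (fun x hx => ?_) ha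
    continuousOn_const (fun x _ => hasDerivWithinAt_const _ _ _)
    (fun x hx h => hneg x ⟨hx.1, hx.2.le⟩ h) (Set.right_mem_Icc.2 hab)
  exact ((hf x ⟨hx.1, hx.2.le⟩).mono (Set.Icc_subset_Icc_left hx.1)).mono_of_mem_nhdsWithin
    (Icc_mem_nhdsGE hx.2)

/-- If `|w| ≤ c` with `d * c < 1`, then `√(1 + (d * k) ^ 2) * |w| < k` for large `k`. -/
theorem sqrt_one_add_sq_mul_abs_lt {d c w k : ℝ} (hd : 0 < d) (hc : 0 ≤ c) (hdc : d * c < 1)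
    (hw : |w| ≤ c) (hk : (c + 1) / (1 - (d * c) ^ 2) ≤ k) :
    Real.sqrt (1 + (d * k) ^ 2) * |w| < k := by
  have hdc0 : 0 ≤ d * c := by positivity
  have hp : 0 < 1 - (d * c) ^ 2 := by nlinarith
  have hk1 : c + 1 ≤ k * (1 - (d * c) ^ 2) := (div_le_iff₀ hp).1 hk
  have hk0 : 0 < k := lt_of_lt_of_le (by positivity) hk
  have hck : c + 1 ≤ k := by nlinarith [mul_nonneg hk0.le (sq_nonneg (d * c))]
  refine lt_of_le_of_lt (mul_le_mul_of_nonneg_left hw (Real.sqrt_nonneg _)) ?_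
  refine lt_of_pow_lt_pow_left₀ 2 hk0.le ?_
  rw [mul_pow, Real.sq_sqrt (by positivity)]
  nlinarith [mul_le_mul_of_nonneg_left hk1 hk0.le, mul_nonneg hc (sub_nonneg.2 hck)]

theorem curvature_no_blowup (d κmax Hη : ℝ) (hd : 0 < d) (hκmax : 0 ≤ κmax)
    (hH1 : d * κmax < 1) (hHη : 0 ≤ Hη) (hηsmall : d * Hη < 1 - d * κmax) :
    ∃ K > (0:ℝ), ∀ T : ℝ≥0∞, 0 < T →
      ∀ Vx κr η κ : ℝ → ℝ,
        (ContinuousOn Vx {t : ℝ | 0 ≤ t ∧ ENNReal.ofReal t < T}) →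
        (ContinuousOn κr {t : ℝ | 0 ≤ t ∧ ENNReal.ofReal t < T}) →
        (ContinuousOn η {t : ℝ | 0 ≤ t ∧ ENNReal.ofReal t < T}) →
        (∀ t ∈ {t : ℝ | 0 ≤ t ∧ ENNReal.ofReal t < T}, 0 < Vx t) →
        (∀ t ∈ {t : ℝ | 0 ≤ t ∧ ENNReal.ofReal t < T}, |κr t| ≤ κmax) →
        (∀ t ∈ {t : ℝ | 0 ≤ t ∧ ENNReal.ofReal t < T}, |η t| ≤ Hη) →
        (∀ t ∈ {t : ℝ | 0 ≤ t ∧ ENNReal.ofReal t < T},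
          HasDerivWithinAt κ
            (Vx t * (1 + (d * κ t) ^ 2)
              * (Real.sqrt (1 + (d * κ t) ^ 2) * (κr t + η t) - κ t) / d)
            {t : ℝ | 0 ≤ t ∧ ENNReal.ofReal t < T} t) →
        ∀ t ∈ {t : ℝ | 0 ≤ t ∧ ENNReal.ofReal t < T}, |κ t| ≤ max |κ 0| K := by
  have hc : 0 ≤ κmax + Hη := add_nonneg hκmax hHη
  have hdc : d * (κmax + Hη) < 1 := by linarith [mul_add d κmax Hη]
  have hp : 0 < 1 - (d * (κmax + Hη)) ^ 2 := by
    have : 0 ≤ d * (κmax + Hη) := by positivity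
    nlinarith
  refine ⟨(κmax + Hη + 1) / (1 - (d * (κmax + Hη)) ^ 2), by positivity, ?_⟩
  intro T _ Vx κr η κ _ _ _ hV hr hη hκ t ht
  set M := max |κ 0| ((κmax + Hη + 1) / (1 - (d * (κmax + Hη)) ^ 2))
  have hsub : Set.Icc 0 t ⊆ {t : ℝ | 0 ≤ t ∧ ENNReal.ofReal t < T} := fun x hx =>
    ⟨hx.1, (ENNReal.ofReal_le_ofReal hx.2).trans_lt ht.2⟩
  have hderiv := fun x (hx : x ∈ Set.Icc 0 t) => (hκ x (hsub hx)).mono hsub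
  have habs : ∀ x ∈ Set.Icc 0 t,
      |Real.sqrt (1 + (d * M) ^ 2) * (κr x + η x)| < M := fun x hx => by
    rw [abs_mul, abs_of_nonneg (Real.sqrt_nonneg _)]
    exact sqrt_one_add_sq_mul_abs_lt hd hc hdc
      ((abs_add_le _ _).trans (add_le_add (hr x (hsub hx)) (hη x (hsub hx)))) (le_max_right _ _)
  have h0 : |κ 0| ≤ M := le_max_left _ _
  rw [abs_le']
  constructor
  · refine le_of_hasDerivWithinAt_neg_of_eq ht.1 hderiv ((le_abs_self _).trans h0) ?_
    intro x hx hxM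
    have hVx := hV x (hsub hx)
    rw [hxM]
    exact div_neg_of_neg_of_pos (mul_neg_of_pos_of_neg (by positivity)
      (by linarith [(abs_lt.1 (habs x hx)).2])) hd
  · refine le_of_hasDerivWithinAt_neg_of_eq (f := fun x => -κ x) ht.1
      (fun x hx => (hderiv x hx).fun_neg) ((neg_le_abs _).trans h0) ?_
    intro x hx hxM
    have hVx := hV x (hsub hx)
    rw [show κ x = -M by linarith, mul_neg, neg_sq]
    exact neg_neg_of_pos (div_pos (mul_pos (by positivity)
      (by linarith [(abs_lt.1 (habs x hx)).1])) hd)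
end

section
/- Let e_p, e_q, θ, ψ_r : I → ℝ be differentiable functions on an interval I and κ_r, u₁ : I → ℝ functions such that ė_p = cos θ − cos ψ_r − u₁·cos ψ_r, ė_q = sin θ − sin ψ_r − u₁·sin ψ_r, and ψ̇_r = (1 + u₁)·κ_r on I. Define ξ := θ − ψ_r, y₁ := e_p·cos ψ_r + e_q·sin ψ_r, and y₂ := −e_p·sin ψ_r + e_q·cos ψ_r. Then on I: ẏ₁ = −u₁ + (cos ξ − 1) + (1 + u₁)·κ_r·y₂ and ẏ₂ = sin ξ − (1 + u₁)·κ_r·y₁. -/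
theorem rotated_error_dynamics (I : Set ℝ) (hI : I.OrdConnected)
    (ep eq' θ ψr κr u₁ : ℝ → ℝ)
    (hep : ∀ t ∈ I, HasDerivWithinAt ep
      (Real.cos (θ t) - Real.cos (ψr t) - u₁ t * Real.cos (ψr t)) I t)
    (heq : ∀ t ∈ I, HasDerivWithinAt eq'
      (Real.sin (θ t) - Real.sin (ψr t) - u₁ t * Real.sin (ψr t)) I t)
    (hψr : ∀ t ∈ I, HasDerivWithinAt ψr ((1 + u₁ t) * κr t) I t) :
    ∀ t ∈ I,
      HasDerivWithinAt (fun s => ep s * Real.cos (ψr s) + eq' s * Real.sin (ψr s))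
        (-(u₁ t) + (Real.cos (θ t - ψr t) - 1)
          + (1 + u₁ t) * κr t * (-(ep t) * Real.sin (ψr t) + eq' t * Real.cos (ψr t))) I t ∧
      HasDerivWithinAt (fun s => -(ep s) * Real.sin (ψr s) + eq' s * Real.cos (ψr s))
        (Real.sin (θ t - ψr t)
          - (1 + u₁ t) * κr t * (ep t * Real.cos (ψr t) + eq' t * Real.sin (ψr t))) I t := by
  intro t ht
  have hc := (hψr t ht).cos
  have hs := (hψr t ht).sin
  have pyth := Real.sin_sq_add_cos_sq (ψr t)
  refine ⟨(((hep t ht).mul hc).add ((heq t ht).mul hs)).congr_deriv ?_,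
    (((hep t ht).neg.mul hs).add ((heq t ht).mul hc)).congr_deriv ?_⟩
  · rw [Real.cos_sub]
    linear_combination (-1 - u₁ t) * pyth
  · simp only [Pi.neg_apply]
    rw [Real.sin_sub]
    ring
end

section
/- Let k₁, k₂, C₁, C₂, M, Υ > 0, κ_max ≥ 0, let A = [[0, 1], [−k₁, −k₂]], and let P be a symmetric real 2×2 matrix satisfying PA + AᵀP + P²/Υ² = −I₂. Let κ_r : [0,∞) → ℝ be continuous with |κ_r(t)| ≤ κ_max, and let (y₁, y₂, ξ, η) : [0,∞) → ℝ⁴ be a solution of ẏ₁ = −C₁σ(y₁) + (cos ξ − 1) + μ·y₂, ẏ₂ = sin ξ − μ·y₁, ξ̇ = η − κ_r·C₁σ(y₁), η̇ = −k₁ξ − k₂η − C₂σ(y₂), where μ := κ_r·(1 + C₁σ(y₁)). Define V := M·ZᵀPZ + k₁(y₁² + y₂²)/2 + η·y₂ + k₂·y₂·ξ with Z = (ξ, η)ᵀ. Then for all t ≥ 0, dV/dt ≤ −M(ξ² + η²) − k₁C₁·y₁σ(y₁) − C₂·y₂σ(y₂) + MΥ²((κ_r·C₁σ(y₁))² + (C₂σ(y₂))²)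 + k₁y₂(sin ξ − ξ) + k₁y₁(cos ξ − 1) − μηy₁ + η·sin ξ − k₂y₂κ_rC₁σ(y₁) − k₂ξμy₁ + k₂ξ·sin ξ. -/
open Matrix

/-- If `P` solves the Riccati equation for the companion matrix `A = !![0, 1; -k₁, -k₂]`, the
derivative `2 (P z)ᵀ (A z + d)` of the quadratic form `zᵀ P z` along `ż = A z + d`, with
`z = (x, e)` and `d = (a, b)`, is at most `-|z|² + Υ² |d|²`. -/
theorem riccati_form_deriv_le {k₁ k₂ Υ : ℝ} (hΥ : Υ ≠ 0)
    {P : Matrix (Fin 2) (Fin 2) ℝ} (hPsymm : P.IsSymm)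
    (hRic : P * (!![0, 1; -k₁, -k₂] : Matrix (Fin 2) (Fin 2) ℝ)
        + (!![0, 1; -k₁, -k₂] : Matrix (Fin 2) (Fin 2) ℝ)ᵀ * P
        + (Υ ^ 2)⁻¹ • (P * P) = -1) (x e a b : ℝ) :
    2 * ((P 0 0 * x + P 0 1 * e) * (e + a)
        + (P 0 1 * x + P 1 1 * e) * (-k₁ * x - k₂ * e + b)) ≤
      -(x ^ 2 + e ^ 2) + Υ ^ 2 * (a ^ 2 + b ^ 2) := by
  have hsymm : P 1 0 = P 0 1 := hPsymm.apply 0 1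
  have h00 := congrFun (congrFun hRic 0) 0
  have h01 := congrFun (congrFun hRic 0) 1
  have h11 := congrFun (congrFun hRic 1) 1
  simp [Matrix.mul_apply, Fin.sum_univ_two, hsymm] at h00 h01 h11
  have hinv : Υ * Υ⁻¹ = 1 := mul_inv_cancel₀ hΥ
  rw [← inv_pow] at h00 h01 h11
  have hu := sq_nonneg (Υ⁻¹ * (P 0 0 * x + P 0 1 * e) - Υ * a)
  have hv := sq_nonneg (Υ⁻¹ * (P 0 1 * x + P 1 1 * e) - Υ * b)
  linear_combination hu + hv + x ^ 2 * h00 + 2 * x * e * h01 + e ^ 2 * h11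
    - 2 * ((P 0 0 * x + P 0 1 * e) * a + (P 0 1 * x + P 1 1 * e) * b) * hinv

/-- The derivative of a symmetric binary quadratic form along a curve. -/
theorem hasDerivWithinAt_quadForm {P : Matrix (Fin 2) (Fin 2) ℝ} (hPsymm : P.IsSymm)
    {x e : ℝ → ℝ} {x' e' t : ℝ} {s : Set ℝ}
    (hx : HasDerivWithinAt x x' s t) (he : HasDerivWithinAt e e' s t) :
    HasDerivWithinAt (fun τ => ![x τ, e τ] ⬝ᵥ P.mulVec ![x τ, e τ])
      (2 * ((P 0 0 * x t + P 0 1 * e t) * x' + (P 0 1 * x t + P 1 1 * e t) * e')) s t := by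
  have hsymm : P 1 0 = P 0 1 := hPsymm.apply 0 1
  have hform : (fun τ => ![x τ, e τ] ⬝ᵥ P.mulVec ![x τ, e τ]) =
      fun τ => P 0 0 * (x τ * x τ) + 2 * P 0 1 * (x τ * e τ) + P 1 1 * (e τ * e τ) := by
    funext τ
    simp [Matrix.mulVec, dotProduct, Fin.sum_univ_two, hsymm]
    ring
  rw [hform]
  exact ((((hx.mul hx).const_mul (P 0 0)).add ((hx.mul he).const_mul (2 * P 0 1))).add
    ((he.mul he).const_mul (P 1 1))).congr_deriv (by ring)

theorem lyapunov_derivative_bound (k₁ k₂ C₁ C₂ M Υ κmax : ℝ)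
    (hk₁ : 0 < k₁) (hk₂ : 0 < k₂) (hC₁ : 0 < C₁) (hC₂ : 0 < C₂)
    (hM : 0 < M) (hΥ : 0 < Υ) (hκmax : 0 ≤ κmax)
    (P : Matrix (Fin 2) (Fin 2) ℝ) (hPsymm : P.IsSymm)
    (hRic : P * (!![0, 1; -k₁, -k₂] : Matrix (Fin 2) (Fin 2) ℝ)
        + (!![0, 1; -k₁, -k₂] : Matrix (Fin 2) (Fin 2) ℝ)ᵀ * P
        + (Υ ^ 2)⁻¹ • (P * P) = -1)
    (κr : ℝ → ℝ) (hκcont : ContinuousOn κr (Set.Ici 0))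
    (hκbdd : ∀ t ≥ (0:ℝ), |κr t| ≤ κmax)
    (y₁ y₂ ξ η : ℝ → ℝ)
    (hy₁ : ∀ t ≥ (0:ℝ), HasDerivWithinAt y₁
      (-C₁ * sat (y₁ t) + (Real.cos (ξ t) - 1)
        + κr t * (1 + C₁ * sat (y₁ t)) * y₂ t) (Set.Ici 0) t)
    (hy₂ : ∀ t ≥ (0:ℝ), HasDerivWithinAt y₂
      (Real.sin (ξ t) - κr t * (1 + C₁ * sat (y₁ t)) * y₁ t) (Set.Ici 0) t)
    (hξ : ∀ t ≥ (0:ℝ), HasDerivWithinAt ξ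
      (η t - κr t * (C₁ * sat (y₁ t))) (Set.Ici 0) t)
    (hη : ∀ t ≥ (0:ℝ), HasDerivWithinAt η
      (-k₁ * ξ t - k₂ * η t - C₂ * sat (y₂ t)) (Set.Ici 0) t) :
    ∀ t ≥ (0:ℝ),
      derivWithin (fun s => M * (![ξ s, η s] ⬝ᵥ P.mulVec ![ξ s, η s])
          + k₁ * (y₁ s ^ 2 + y₂ s ^ 2) / 2 + η s * y₂ s + k₂ * y₂ s * ξ s)
        (Set.Ici 0) t ≤
        -M * (ξ t ^ 2 + η t ^ 2) - k₁ * C₁ * (y₁ t * sat (y₁ t))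
          - C₂ * (y₂ t * sat (y₂ t))
          + M * Υ ^ 2 * ((κr t * (C₁ * sat (y₁ t))) ^ 2 + (C₂ * sat (y₂ t)) ^ 2)
          + k₁ * y₂ t * (Real.sin (ξ t) - ξ t) + k₁ * y₁ t * (Real.cos (ξ t) - 1)
          - (κr t * (1 + C₁ * sat (y₁ t))) * η t * y₁ t + η t * Real.sin (ξ t)
          - k₂ * y₂ t * (κr t * (C₁ * sat (y₁ t)))
          - k₂ * ξ t * (κr t * (1 + C₁ * sat (y₁ t))) * y₁ t
          + k₂ * ξ t * Real.sin (ξ t) := by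
  intro t ht
  have h₁ := hy₁ t ht
  have h₂ := hy₂ t ht
  have hx := hξ t ht
  have he := hη t ht
  have hV := ((((hasDerivWithinAt_quadForm hPsymm hx he).const_mul M).add
    ((((h₁.pow 2).add (h₂.pow 2)).const_mul k₁).div_const 2)).add (he.mul h₂)).add
    ((h₂.const_mul k₂).mul hx)
  refine (hV.derivWithin (uniqueDiffOn_Ici 0 t ht)).trans_le ?_
  have hquad := mul_le_mul_of_nonneg_left (riccati_form_deriv_le hΥ.ne' hPsymm hRic (ξ t) (η t)
    (-(κr t * (C₁ * sat (y₁ t)))) (-(C₂ * sat (y₂ t)))) hM.le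
  norm_num
  linear_combination hquad
end
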